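/- arXiv:1911.01870 — 3 statements merged into one kernel-verified Lean document; each statement's English description precedes it below -/
import Mathlib

section
/- For every t ∈ [0,T] the following hold, where ∂_x X_{s,t}^v ∈ L(H) denotes the Fréchet derivative of x ↦ X_{s,t}^x at v: (a) the map [0,t] ∋ s ↦ ∂_x X_{s,t}^{𝕪_s − 𝕆_s + O_s}( e^{(s−⌊s⌋_θ)A} 𝕗(𝕪_{⌊s⌋_θ}) − F(𝕪_s − 𝕆_s + O_s) ) ∈ H is Borel measurable; (b) ∫_0^t ‖∂_x X_{s,t}^{𝕪_s − 𝕆_s + O_s}( e^{(s−⌊s⌋_θ)A} 𝕗(𝕪_{⌊s⌋_θ}) − F(𝕪_s − 𝕆_s + O_s) )‖_H ds < ∞; and (c) 𝕪_t − X_{0,t}^{ξ + O_0} = 𝕆_t − O_t + ∫_0^t ∂_x X_{s,t}^{𝕪_s − 𝕆_s + O_s}( e^{(s−⌊s⌋_θ)A} 𝕗(𝕪_{⌊s⌋_θ}) − F(𝕪_s − 𝕆_s + O_s) ) ds. -/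
open MeasureTheory Set
open scoped ENNReal RealInnerProductSpace NNReal

section Helpers

open Filter Topology

/-- **Gronwall's inequality** in integral form. -/
theorem le_mul_exp_of_le_add_mul_integral {d : ℝ → ℝ} {a b ε K : ℝ} (hK : 0 < K)
    (hd : Continuous d) (h : ∀ u ∈ Icc a b, d u ≤ ε + K * ∫ r in a..u, d r) :
    ∀ u ∈ Icc a b, d u ≤ ε * Real.exp (K * (u - a)) := by
  have hder : ∀ u, HasDerivAt (fun u => ∫ r in a..u, d r) (d u) u := fun u =>
    intervalIntegral.integral_hasDerivAt_right (hd.intervalIntegrable _ _)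
      (hd.stronglyMeasurableAtFilter _ _) hd.continuousAt
  have key := le_gronwallBound_of_liminf_deriv_right_le (f := fun u => ∫ r in a..u, d r)
    (f' := d) (δ := 0) (K := K) (ε := ε) (a := a) (b := b)
    (fun u _ => (hder u).continuousAt.continuousWithinAt)
    (fun x _ r hr => (hder x).hasDerivWithinAt.liminf_right_slope_le hr) (by simp)
    (fun x hx => by linarith [h x (Ico_subset_Icc_self hx)])
  intro u hu
  have h1 := key u hu
  rw [gronwallBound_of_K_ne_0 hK.ne'] at h1
  have h2 := mul_le_mul_of_nonneg_left h1 hK.le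
  have h3 : K * (0 * Real.exp (K * (u - a)) + ε / K * (Real.exp (K * (u - a)) - 1))
      = ε * Real.exp (K * (u - a)) - ε := by
    field_simp; ring
  linarith [h u hu]

/-- A map which is linear up to `o` of the arguments is differentiable at `0`. -/
theorem differentiableAt_zero_of_approx_linear {V W : Type*} [NormedAddCommGroup V]
    [NormedSpace ℝ V] [FiniteDimensional ℝ V] [NormedAddCommGroup W] [NormedSpace ℝ W]
    [CompleteSpace W] {D : V → W}
    (hD : ∀ η > 0, ∃ δ > 0, ∀ (h k : V) (a b : ℝ), ‖h‖ < δ → ‖k‖ < δ → ‖a • h + b • k‖ < δ →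
      ‖D (a • h + b • k) - a • D h - b • D k‖ ≤ η * (|a| * ‖h‖ + |b| * ‖k‖)) :
    DifferentiableAt ℝ D 0 := by
  have hsc : ∀ (δ : ℝ), 0 < δ → ∀ h : V, ∃ N : ℕ, ∀ n ≥ N, ‖((n : ℝ) + 1)⁻¹ • h‖ < δ := by
    intro δ hδ h
    have h1 : Tendsto (fun n : ℕ => ((n : ℝ) + 1)⁻¹ • h) atTop (𝓝 ((0 : ℝ) • h)) :=
      (by simpa [one_div] using tendsto_one_div_add_atTop_nhds_zero_nat (𝕜 := ℝ)
        : Tendsto (fun n : ℕ => ((n : ℝ) + 1)⁻¹) atTop (𝓝 0)).smul_const h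
    have h2 := h1.norm.eventually_lt_const (u := δ) (by simpa using hδ)
    simpa using h2
  have h0 : D 0 = 0 := by
    obtain ⟨δ, hδ, h⟩ := hD 1 one_pos
    simpa using h 0 0 0 0 (by simpa) (by simpa) (by simpa)
  set q : V → ℕ → W := fun h n => ((n : ℝ) + 1) • D (((n : ℝ) + 1)⁻¹ • h) with hq
  have hlim : ∀ h, ∃ l, Tendsto (q h) atTop (𝓝 l) := by
    intro h
    apply cauchySeq_tendsto_of_complete
    rw [Metric.cauchySeq_iff]
    intro ε hε
    obtain ⟨η, hη, hηε⟩ : ∃ η > 0, η * ‖h‖ < ε :=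
      ⟨ε / (‖h‖ + 1), by positivity, by
        rw [div_mul_eq_mul_div, div_lt_iff₀ (by positivity)]; nlinarith [norm_nonneg h]⟩
    obtain ⟨δ, hδ, hH⟩ := hD η hη
    obtain ⟨N, hN⟩ := hsc δ hδ h
    refine ⟨N, fun m hm n hn => lt_of_le_of_lt ?_ hηε⟩
    have hn0 : (0 : ℝ) < n + 1 := by positivity
    have hm0 : (0 : ℝ) < m + 1 := by positivity
    have e : ((m + 1 : ℝ) * ((n : ℝ) + 1)⁻¹) • ((m : ℝ) + 1)⁻¹ • h + (0 : ℝ) • (0 : V)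
        = ((n : ℝ) + 1)⁻¹ • h := by
      rw [smul_zero, add_zero, smul_smul]; congr 1; field_simp
    have := hH (((m : ℝ) + 1)⁻¹ • h) 0 ((m + 1 : ℝ) * ((n : ℝ) + 1)⁻¹) 0 (hN m hm) (by simpa)
      (by rw [e]; exact hN n hn)
    rw [e] at this
    rw [dist_comm, dist_eq_norm]
    have e2 : q h n - q h m = ((n : ℝ) + 1) • (D (((n : ℝ) + 1)⁻¹ • h) -
        ((m + 1 : ℝ) * ((n : ℝ) + 1)⁻¹) • D (((m : ℝ) + 1)⁻¹ • h) - (0 : ℝ) • D 0) := by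
      simp only [hq, zero_smul, sub_zero, smul_sub, smul_smul]
      congr 2; field_simp
    rw [e2, norm_smul, Real.norm_of_nonneg hn0.le]
    calc _ ≤ ((n : ℝ) + 1) * _ := mul_le_mul_of_nonneg_left this hn0.le
      _ = η * ‖h‖ := by
        rw [norm_smul, abs_of_pos (by positivity), Real.norm_of_nonneg (by positivity)]
        simp; field_simp
  choose J hJ using hlim
  have hJlin : ∀ (h k : V) (a b : ℝ), J (a • h + b • k) = a • J h + b • J k := by
    intro h k a b
    rw [← sub_eq_zero, ← norm_le_zero_iff]
    apply le_of_forall_pos_le_add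
    intro ε hε
    rw [zero_add]
    set S := |a| * ‖h‖ + |b| * ‖k‖ with hS
    have hS0 : 0 ≤ S := by positivity
    obtain ⟨η, hη, hηε⟩ : ∃ η > 0, η * S ≤ ε :=
      ⟨ε / (S + 1), by positivity, by
        rw [div_mul_eq_mul_div, div_le_iff₀ (by positivity)]; nlinarith⟩
    obtain ⟨δ, hδ, hH⟩ := hD η hη
    obtain ⟨N1, hN1⟩ := hsc δ hδ h
    obtain ⟨N2, hN2⟩ := hsc δ hδ k
    obtain ⟨N3, hN3⟩ := hsc δ hδ (a • h + b • k)
    have ht := ((hJ (a • h + b • k)).sub (((hJ h).const_smul a).add ((hJ k).const_smul b))).norm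
    refine le_of_tendsto ht ?_
    filter_upwards [eventually_ge_atTop N1, eventually_ge_atTop N2, eventually_ge_atTop N3]
      with n h1 h2 h3
    have hn0 : (0 : ℝ) < n + 1 := by positivity
    have e : a • ((n : ℝ) + 1)⁻¹ • h + b • ((n : ℝ) + 1)⁻¹ • k
        = ((n : ℝ) + 1)⁻¹ • (a • h + b • k) := by
      rw [smul_add, smul_comm, smul_comm b]
    have := hH _ _ a b (hN1 n h1) (hN2 n h2) (by rw [e]; exact hN3 n h3)
    rw [e] at this
    have e2 : q (a • h + b • k) n - (a • q h n + b • q k n) = ((n : ℝ) + 1) •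
        (D (((n : ℝ) + 1)⁻¹ • (a • h + b • k)) - a • D (((n : ℝ) + 1)⁻¹ • h)
          - b • D (((n : ℝ) + 1)⁻¹ • k)) := by
      simp only [hq]; module
    rw [e2, norm_smul, Real.norm_of_nonneg hn0.le]
    calc _ ≤ ((n : ℝ) + 1) * _ := mul_le_mul_of_nonneg_left this hn0.le
      _ = η * S := by
        rw [norm_smul, norm_smul, Real.norm_of_nonneg (by positivity), hS]
        field_simp
      _ ≤ ε := hηε
  let L : V →ₗ[ℝ] W :=
    { toFun := J
      map_add' := fun h k => by simpa using hJlin h k 1 1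
      map_smul' := fun a h => by simpa using hJlin h 0 a 0 }
  refine (HasFDerivAt.of_isLittleO (f' := LinearMap.toContinuousLinearMap L) ?_).differentiableAt
  rw [Asymptotics.isLittleO_iff]
  intro η hη
  obtain ⟨δ, hδ, hH⟩ := hD η hη
  filter_upwards [Metric.ball_mem_nhds (0 : V) hδ] with h hh
  have hh' : ‖h‖ < δ := by simpa using hh
  simp only [h0, sub_zero]
  change ‖D h - J h‖ ≤ _
  refine le_of_tendsto (tendsto_const_nhds.sub (hJ h)).norm ?_
  obtain ⟨N, hN⟩ := hsc δ hδ h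
  filter_upwards [eventually_ge_atTop N] with n hn
  have hn0 : (0 : ℝ) < n + 1 := by positivity
  have e : ((n : ℝ) + 1) • ((n : ℝ) + 1)⁻¹ • h + (0 : ℝ) • (0 : V) = h := by
    rw [smul_inv_smul₀ hn0.ne']; simp
  have := hH (((n : ℝ) + 1)⁻¹ • h) 0 ((n : ℝ) + 1) 0 (hN n hn) (by simpa) (by rwa [e])
  rw [e] at this
  calc ‖D h - q h n‖ = _ := by simp [hq]
    _ ≤ _ := this
    _ = η * ‖h‖ := by
      rw [norm_smul, abs_of_pos hn0, Real.norm_of_nonneg (by positivity)]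
      simp only [abs_zero, zero_mul, add_zero]; field_simp

/-- A time-dependent vector field which is jointly continuous and continuously differentiable
in space, jointly in time and space. -/
structure IsC1Field {V : Type*} [NormedAddCommGroup V] [NormedSpace ℝ V] (G : ℝ → V → V) :
    Prop where
  cont : Continuous fun p : ℝ × V => G p.1 p.2
  diff : ∀ t, Differentiable ℝ (G t)
  cont_fderiv : Continuous fun p : ℝ × V => fderiv ℝ (G p.1) p.2

/-- `Φ s t v` is the value at time `t` of a solution of the integral equation
`x t = v + ∫ u in s..t, G u (x u)` on `[s, T]`, for `0 ≤ s`. -/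
structure IsSemiflow {V : Type*} [NormedAddCommGroup V] [NormedSpace ℝ V] (G : ℝ → V → V)
    (T : ℝ) (Φ : ℝ → ℝ → V → V) : Prop where
  cont : ∀ s ∈ Icc 0 T, ∀ v, ContinuousOn (fun t => Φ s t v) (Icc s T)
  eq : ∀ s ∈ Icc 0 T, ∀ v, ∀ t ∈ Icc s T, Φ s t v = v + ∫ u in s..t, G u (Φ s u v)

section Flow

variable {V : Type*} [NormedAddCommGroup V] [NormedSpace ℝ V]
  {G : ℝ → V → V} {T : ℝ} {Φ : ℝ → ℝ → V → V}

theorem IsC1Field.continuousOn_comp (hG : IsC1Field G) {φ : ℝ → V} {S : Set ℝ}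
    (hφ : ContinuousOn φ S) : ContinuousOn (fun r => G r (φ r)) S :=
  hG.cont.comp_continuousOn (continuousOn_id.prodMk hφ)

theorem IsC1Field.exists_lipschitz [ProperSpace V] (hG : IsC1Field G) (T R : ℝ) :
    ∃ K > 0, ∀ t ∈ Icc 0 T, ∀ x ∈ Metric.closedBall (0 : V) R,
      ∀ y ∈ Metric.closedBall (0 : V) R, ‖G t y - G t x‖ ≤ K * ‖y - x‖ := by
  obtain ⟨C, hC⟩ := (isCompact_Icc (a := (0 : ℝ)) (b := T)).prod
    (isCompact_closedBall (0 : V) R) |>.exists_bound_of_continuousOn hG.cont_fderiv.continuousOn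
  refine ⟨max C 1, by positivity, fun t ht x hx y hy => ?_⟩
  exact (convex_closedBall (0 : V) R).norm_image_sub_le_of_norm_fderiv_le
    (fun z _ => hG.diff t z) (fun z hz => (hC (t, z) ⟨ht, hz⟩).trans (le_max_left _ _)) hx hy

theorem IsC1Field.exists_bound [ProperSpace V] (hG : IsC1Field G) (T R : ℝ) :
    ∃ M > 0, ∀ t ∈ Icc 0 T, ∀ x ∈ Metric.closedBall (0 : V) R, ‖G t x‖ ≤ M := by
  obtain ⟨C, hC⟩ := (isCompact_Icc (a := (0 : ℝ)) (b := T)).prod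
    (isCompact_closedBall (0 : V) R) |>.exists_bound_of_continuousOn hG.cont.continuousOn
  exact ⟨max C 1, by positivity, fun t ht x hx => (hC (t, x) ⟨ht, hx⟩).trans (le_max_left _ _)⟩

theorem IsC1Field.exists_linearization [ProperSpace V] (hG : IsC1Field G) (T R : ℝ) {η : ℝ}
    (hη : 0 < η) :
    ∃ δ > 0, ∀ t ∈ Icc 0 T, ∀ x ∈ Metric.closedBall (0 : V) R, ∀ k : V, ‖k‖ ≤ δ →
      ‖G t (x + k) - G t x - fderiv ℝ (G t) x k‖ ≤ η * ‖k‖ := by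
  have huc := ((isCompact_Icc (a := (0 : ℝ)) (b := T)).prod
    (isCompact_closedBall (0 : V) (R + 1))).uniformContinuousOn_of_continuous
      hG.cont_fderiv.continuousOn
  rw [Metric.uniformContinuousOn_iff] at huc
  obtain ⟨δ, hδ, h⟩ := huc η hη
  refine ⟨min (δ / 2) 1, by positivity, fun t ht x hx k hk => ?_⟩
  have hx' : ‖x‖ ≤ R := by simpa using hx
  have key := (convex_closedBall x ‖k‖).norm_image_sub_le_of_norm_fderiv_le'
    (f := G t) (φ := fderiv ℝ (G t) x) (C := η) (x := x) (y := x + k)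
    (fun z _ => hG.diff t z) (fun z hz => ?_) (by simp) (by simp)
  · simpa using key
  have hz' : ‖z - x‖ ≤ ‖k‖ := by simpa [dist_eq_norm] using hz
  have h1 : ‖k‖ ≤ δ / 2 := hk.trans (min_le_left _ _)
  have h2 : ‖k‖ ≤ 1 := hk.trans (min_le_right _ _)
  have hz2 : ‖z‖ ≤ R + 1 := by
    calc ‖z‖ = ‖(z - x) + x‖ := by simp
      _ ≤ ‖z - x‖ + ‖x‖ := norm_add_le _ _
      _ ≤ _ := by linarith
  have := h (t, z) ⟨ht, by simpa using hz2⟩ (t, x) ⟨ht, by simp; linarith⟩ (by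
    rw [Prod.dist_eq]; simp [dist_eq_norm]; linarith)
  rw [dist_eq_norm] at this
  exact this.le

/-- Stability estimate: a curve which approximately shadows `φ` stays close to it. -/
theorem norm_sub_le_of_shadow {φ ψ : ℝ → V} {a b ε K R : ℝ} (hK : 0 < K)
    (hφ : ContinuousOn φ (Icc a b)) (hψ : ContinuousOn ψ (Icc a b))
    (hR : ∀ u ∈ Icc a b, ‖φ u‖ ≤ R)
    (hL : ∀ u ∈ Icc a b, ∀ x ∈ Metric.closedBall (0 : V) (R + 1),
      ∀ y ∈ Metric.closedBall (0 : V) (R + 1), ‖G u y - G u x‖ ≤ K * ‖y - x‖)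
    (h : ∀ u ∈ Icc a b, ‖ψ u - φ u‖ ≤ ε + ‖∫ r in a..u, (G r (ψ r) - G r (φ r))‖)
    (hε0 : 0 ≤ ε) (hε : ε * Real.exp (K * (b - a)) < 1) :
    ∀ u ∈ Icc a b, ‖ψ u - φ u‖ ≤ ε * Real.exp (K * (u - a)) := by
  by_cases hab : a ≤ b
  swap
  · intro u hu; exact absurd (hu.1.trans hu.2) hab
  have hdc : ContinuousOn (fun u => ‖ψ u - φ u‖) (Icc a b) := (hψ.sub hφ).norm
  have step : ∀ c ∈ Icc a b, (∀ u ∈ Icc a c, ‖ψ u - φ u‖ ≤ 1) →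
      ∀ u ∈ Icc a c, ‖ψ u - φ u‖ ≤ ε * Real.exp (K * (u - a)) := by
    intro c hc h1
    have hsub : Icc a c ⊆ Icc a b := Icc_subset_Icc_right hc.2
    let d : ℝ → ℝ := IccExtend hc.1 ((Icc a c).domRestrict fun u => ‖ψ u - φ u‖)
    have hd : Continuous d := (hdc.mono hsub).domRestrict.Icc_extend'
    have hdeq : ∀ u ∈ Icc a c, d u = ‖ψ u - φ u‖ := fun u hu => by
      simp only [d, IccExtend_of_mem _ _ hu, domRestrict_apply]
    intro u hu
    rw [← hdeq u hu]
    refine le_mul_exp_of_le_add_mul_integral (b := c) hK hd (fun u hu => ?_) u hu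
    rw [hdeq u hu]
    refine (h u (hsub hu)).trans (add_le_add_right ?_ _)
    rw [← intervalIntegral.integral_const_mul]
    refine intervalIntegral.norm_integral_le_of_norm_le hu.1 ?_
      ((hd.const_mul K).intervalIntegrable _ _)
    refine Filter.Eventually.of_forall fun r hr => ?_
    have hr' : r ∈ Icc a c := ⟨hr.1.le, hr.2.trans hu.2⟩
    rw [hdeq r hr']
    have hφr := hR r (hsub hr')
    refine hL r (hsub hr') _ (by simp; linarith) _ ?_
    have := norm_add_le (ψ r - φ r) (φ r)
    rw [sub_add_cancel] at this
    simp; linarith [h1 r hr']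
  by_cases hex : ∀ u ∈ Icc a b, ‖ψ u - φ u‖ ≤ 1
  · exact step b ⟨hab, le_rfl⟩ hex
  exfalso
  push Not at hex
  obtain ⟨u0, hu0, hu1⟩ := hex
  have hcl : IsCompact (Icc a b ∩ (fun u => ‖ψ u - φ u‖) ⁻¹' Ici 1) :=
    isCompact_Icc.of_isClosed_subset (hdc.preimage_isClosed_of_isClosed isClosed_Icc isClosed_Ici)
      inter_subset_left
  obtain ⟨c, ⟨hc, hc1⟩, hmin⟩ := hcl.exists_isLeast ⟨u0, hu0, hu1.le⟩
  have hc1' : 1 ≤ ‖ψ c - φ c‖ := hc1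
  have hlt : ∀ u ∈ Icc a b, u < c → ‖ψ u - φ u‖ < 1 := fun u hu huc => by
    by_contra hcon
    exact absurd (hmin ⟨hu, not_lt.1 hcon⟩) (not_le.2 huc)
  have hbound : ε * Real.exp (K * (c - a)) < 1 :=
    lt_of_le_of_lt (mul_le_mul_of_nonneg_left (Real.exp_le_exp.2
      (mul_le_mul_of_nonneg_left (by linarith [hc.2]) hK.le)) hε0) hε
  rcases hc.1.eq_or_lt with rfl | hac
  · have := h a hc
    simp only [intervalIntegral.integral_same, norm_zero, add_zero] at this
    simp at hbound
    linarith
  have hle : ‖ψ c - φ c‖ ≤ 1 := by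
    have hcont : ContinuousWithinAt (fun u => ‖ψ u - φ u‖) (Ico a c) c :=
      (hdc c hc).mono (Ico_subset_Icc_self.trans (Icc_subset_Icc_right hc.2))
    have : c ∈ closure (Ico a c) := by
      rw [closure_Ico hac.ne]; exact ⟨hac.le, le_rfl⟩
    have : (𝓝[Ico a c] c).NeBot := mem_closure_iff_nhdsWithin_neBot.1 this
    refine le_of_tendsto hcont ?_
    filter_upwards [self_mem_nhdsWithin] with u hu
    exact (hlt u ⟨hu.1, hu.2.le.trans hc.2⟩ hu.2).le
  have := step c hc (fun u hu => by
    rcases hu.2.eq_or_lt with rfl | h'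
    · exact hle
    · exact (hlt u ⟨hu.1, hu.2.trans hc.2⟩ h').le) c ⟨hac.le, le_rfl⟩
  linarith

theorem IsSemiflow.self (hΦ : IsSemiflow G T Φ) {s : ℝ} (hs : s ∈ Icc 0 T) (v : V) :
    Φ s s v = v := by
  simpa using hΦ.eq s hs v s ⟨le_rfl, hs.2⟩

theorem IsSemiflow.intervalIntegrable (hG : IsC1Field G) (hΦ : IsSemiflow G T Φ) {s a b : ℝ}
    (hs : s ∈ Icc 0 T) (v : V) (ha : a ∈ Icc s T) (hb : b ∈ Icc s T) :
    IntervalIntegrable (fun r => G r (Φ s r v)) volume a b :=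
  (hG.continuousOn_comp ((hΦ.cont s hs v).mono (uIcc_subset_Icc ha hb))).intervalIntegrable

theorem IsSemiflow.eq_add (hG : IsC1Field G) (hΦ : IsSemiflow G T Φ) {s a b : ℝ}
    (hs : s ∈ Icc 0 T) (v : V) (ha : a ∈ Icc s T) (hb : b ∈ Icc s T) :
    Φ s b v = Φ s a v + ∫ r in a..b, G r (Φ s r v) := by
  have hs' : s ∈ Icc s T := ⟨le_rfl, hs.2⟩
  rw [hΦ.eq s hs v b hb, hΦ.eq s hs v a ha, add_assoc, intervalIntegral.integral_add_adjacent_intervals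
    (hΦ.intervalIntegrable hG hs v hs' ha) (hΦ.intervalIntegrable hG hs v ha hb)]

theorem IsSemiflow.exists_bound (hΦ : IsSemiflow G T Φ) {s : ℝ}
    (hs : s ∈ Icc 0 T) (v : V) : ∃ R, ∀ u ∈ Icc s T, ‖Φ s u v‖ ≤ R :=
  isCompact_Icc.exists_bound_of_continuousOn (hΦ.cont s hs v)

theorem IsSemiflow.comp [ProperSpace V] (hG : IsC1Field G) (hΦ : IsSemiflow G T Φ)
    {s r t : ℝ} (hs : s ∈ Icc 0 T) (hr : r ∈ Icc s T) (ht : t ∈ Icc r T) (v : V) :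
    Φ r t (Φ s r v) = Φ s t v := by
  have hr0 : r ∈ Icc 0 T := ⟨hs.1.trans hr.1, hr.2⟩
  have hsub : Icc r T ⊆ Icc s T := Icc_subset_Icc_left hr.1
  obtain ⟨R, hR⟩ := hΦ.exists_bound hs v
  obtain ⟨K, hK, hL⟩ := hG.exists_lipschitz T (R + 1)
  have := norm_sub_le_of_shadow (φ := fun u => Φ s u v) (ψ := fun u => Φ r u (Φ s r v))
    (a := r) (b := T) (ε := 0) hK ((hΦ.cont s hs v).mono hsub) (hΦ.cont r hr0 _)
    (fun u hu => hR u (hsub hu)) (fun u hu => hL u ⟨hr0.1.trans hu.1, hu.2⟩)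
    (fun u hu => ?_) le_rfl (by simp) t ht
  · rw [zero_mul, norm_le_zero_iff, sub_eq_zero] at this
    exact this
  · have hr' : r ∈ Icc r T := ⟨le_rfl, hr.2⟩
    rw [zero_add, intervalIntegral.integral_sub (hΦ.intervalIntegrable hG hr0 _ hr' hu)
      (hΦ.intervalIntegrable hG hs v hr (hsub hu)), hΦ.eq r hr0 _ u hu,
      hΦ.eq_add hG hs v hr (hsub hu)]
    apply le_of_eq; congr 1; abel

/-- Local Lipschitz continuity in the initial value, with constants which only depend on a bound
of the trajectory. -/
theorem IsSemiflow.exists_lipschitz [ProperSpace V] (hG : IsC1Field G) (hΦ : IsSemiflow G T Φ)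
    (R : ℝ) : ∃ C > 0, ∃ δ > 0, ∀ s ∈ Icc 0 T, ∀ v₀, (∀ u ∈ Icc s T, ‖Φ s u v₀‖ ≤ R) →
      ∀ v, ‖v - v₀‖ < δ → ∀ u ∈ Icc s T, ‖Φ s u v - Φ s u v₀‖ ≤ C * ‖v - v₀‖ := by
  obtain ⟨K, hK, hL⟩ := hG.exists_lipschitz T (R + 1)
  refine ⟨Real.exp (K * T), Real.exp_pos _, (Real.exp (K * T))⁻¹, by positivity,
    fun s hs v₀ hR v hv u hu => ?_⟩
  have hexp : ∀ u ≤ T, Real.exp (K * (u - s)) ≤ Real.exp (K * T) := fun u hu =>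
    Real.exp_le_exp.2 (mul_le_mul_of_nonneg_left (by linarith [hs.1]) hK.le)
  refine (norm_sub_le_of_shadow (φ := fun u => Φ s u v₀) (ψ := fun u => Φ s u v)
    (ε := ‖v - v₀‖) hK (hΦ.cont s hs v₀) (hΦ.cont s hs v) hR
    (fun u hu => hL u ⟨hs.1.trans hu.1, hu.2⟩) (fun u hu => ?_) (norm_nonneg _)
    ?_ u hu).trans ?_
  · have hs' : s ∈ Icc s T := ⟨le_rfl, hs.2⟩
    rw [intervalIntegral.integral_sub (hΦ.intervalIntegrable hG hs _ hs' hu)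
      (hΦ.intervalIntegrable hG hs _ hs' hu), hΦ.eq s hs v u hu, hΦ.eq s hs v₀ u hu]
    exact (congrArg _ (by abel)).trans_le (norm_add_le _ _)
  · refine (mul_le_mul_of_nonneg_left (hexp T le_rfl) (norm_nonneg _)).trans_lt ?_
    rwa [← lt_div_iff₀ (Real.exp_pos _), one_div]
  · rw [mul_comm]
    exact mul_le_mul_of_nonneg_right (hexp u hu.2) (norm_nonneg _)

/-- Joint continuity of the semiflow in the initial time and the initial value, with the
trajectory frozen before its initial time. -/
theorem IsSemiflow.exists_shadow [ProperSpace V] (hG : IsC1Field G) (hΦ : IsSemiflow G T Φ)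
    {s₀ : ℝ} (hs₀ : s₀ ∈ Icc 0 T) (v₀ : V) :
    ∃ φ : ℝ → V, Continuous φ ∧ (∀ u ∈ Icc s₀ T, φ u = Φ s₀ u v₀) ∧ (∀ u ≤ s₀, φ u = v₀) ∧
      ∃ C > 0, ∃ δ > 0, ∀ s ∈ Icc 0 T, ∀ v, ‖v - v₀‖ + |s - s₀| < δ →
        ∀ u ∈ Icc s T, ‖Φ s u v - φ u‖ ≤ C * (‖v - v₀‖ + |s - s₀|) := by
  let φ : ℝ → V := IccExtend hs₀.2 ((Icc s₀ T).domRestrict fun u => Φ s₀ u v₀)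
  have hφc : Continuous φ := (hΦ.cont s₀ hs₀ v₀).domRestrict.Icc_extend'
  have hφ1 : ∀ u ∈ Icc s₀ T, φ u = Φ s₀ u v₀ := fun u hu => by
    simp only [φ, IccExtend_of_mem _ _ hu, domRestrict_apply]
  have hφ2 : ∀ u ≤ s₀, φ u = v₀ := fun u hu => by
    simp only [φ, IccExtend_of_le_left _ _ hu, domRestrict_apply, hΦ.self hs₀]
  refine ⟨φ, hφc, hφ1, hφ2, ?_⟩
  obtain ⟨R, hR⟩ := isCompact_Icc (a := (0 : ℝ)) (b := T) |>.exists_bound_of_continuousOn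
    hφc.continuousOn
  obtain ⟨K, hK, hL⟩ := hG.exists_lipschitz T (R + 1)
  obtain ⟨M, hM, hMb⟩ := hG.exists_bound T R
  have hMφ : ∀ u ∈ Icc 0 T, ‖G u (φ u)‖ ≤ M := fun u hu => hMb u hu _ (by simpa using hR u hu)
  set B := 1 + 2 * M with hB
  have hBpos : 0 < B := by positivity
  have hGφ : ∀ a b, IntervalIntegrable (fun r => G r (φ r)) volume a b := fun a b =>
    (hG.cont.comp (continuous_id.prodMk hφc)).intervalIntegrable _ _
  have hint : ∀ a ∈ Icc 0 T, ∀ b ∈ Icc 0 T, ‖∫ r in a..b, G r (φ r)‖ ≤ M * |b - a| :=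
    fun a ha b hb => intervalIntegral.norm_integral_le_of_norm_le_const fun r hr =>
      hMφ r (uIcc_subset_Icc ha hb (uIoc_subset_uIcc hr))
  refine ⟨B * Real.exp (K * T), by positivity, (B * Real.exp (K * T))⁻¹, by positivity,
    fun s hs v hv u hu => ?_⟩
  set e := ‖v - v₀‖ + |s - s₀| with he
  have he0 : 0 ≤ e := by positivity
  have hexp : ∀ u ≤ T, Real.exp (K * (u - s)) ≤ Real.exp (K * T) := fun u hu =>
    Real.exp_le_exp.2 (mul_le_mul_of_nonneg_left (by linarith [hs.1]) hK.le)
  have hsub : Icc s T ⊆ Icc 0 T := Icc_subset_Icc_left hs.1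
  refine (norm_sub_le_of_shadow (φ := φ) (ψ := fun u => Φ s u v)
    (ε := B * e) hK hφc.continuousOn (hΦ.cont s hs v) (fun u hu => hR u (hsub hu))
    (fun u hu => hL u (hsub hu)) (fun u hu => ?_) (by positivity)
    ?_ u hu).trans ?_
  · have hs' : s ∈ Icc s T := ⟨le_rfl, hs.2⟩
    set m := max s₀ u with hm
    have hmem : m ∈ Icc s₀ T := ⟨le_max_left _ _, max_le hs₀.2 hu.2⟩
    have hm0 : m ∈ Icc 0 T := ⟨hs₀.1.trans hmem.1, hmem.2⟩
    have hφm : φ u = φ m := by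
      rcases le_total u s₀ with h | h
      · rw [hm, max_eq_left h, hφ2 u h, hφ2 s₀ le_rfl]
      · rw [hm, max_eq_right h]
    have hφeq : φ u = v₀ + ∫ r in s₀..m, G r (φ r) := by
      rw [hφm, hφ1 m hmem, hΦ.eq s₀ hs₀ v₀ m hmem]
      congr 1
      refine intervalIntegral.integral_congr fun r hr => ?_
      rw [uIcc_of_le hmem.1] at hr
      simp only [hφ1 r ⟨hr.1, hr.2.trans hmem.2⟩]
    have hsplit : ∫ r in s..u, G r (φ r) = (∫ r in s..s₀, G r (φ r)) +
        (∫ r in s₀..m, G r (φ r)) + ∫ r in m..u, G r (φ r) := by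
      rw [intervalIntegral.integral_add_adjacent_intervals (hGφ _ _) (hGφ _ _),
        intervalIntegral.integral_add_adjacent_intervals (hGφ _ _) (hGφ _ _)]
    have hmu : |u - m| ≤ |s - s₀| := by
      rcases le_total u s₀ with h | h
      · rw [hm, max_eq_left h, abs_of_nonpos (by linarith), abs_of_nonpos (by linarith [hu.1])]
        linarith [hu.1]
      · rw [hm, max_eq_right h]; simp
    have h1 := hint s hs s₀ hs₀
    have h2 := (hint m hm0 u (hsub hu)).trans (mul_le_mul_of_nonneg_left hmu hM.le)
    rw [abs_sub_comm] at h1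
    have hid : Φ s u v - φ u = ((v - v₀) + (∫ r in s..s₀, G r (φ r)) + ∫ r in m..u, G r (φ r))
        + ∫ r in s..u, (G r (Φ s r v) - G r (φ r)) := by
      rw [intervalIntegral.integral_sub (hΦ.intervalIntegrable hG hs _ hs' hu) (hGφ _ _),
        hsplit, hφeq, hΦ.eq s hs v u hu]
      abel
    rw [hid]
    refine (norm_add_le _ _).trans (add_le_add_left (norm_add₃_le.trans ?_) _)
    have : 0 ≤ |s - s₀| := abs_nonneg _
    have : 0 ≤ M * ‖v - v₀‖ := by positivity
    rw [hB, he]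
    linarith
  · have h1 : B * e * Real.exp (K * (T - s)) ≤ (B * Real.exp (K * T)) * e := by
      nlinarith [mul_le_mul_of_nonneg_left (hexp T le_rfl) (mul_nonneg hBpos.le he0)]
    refine h1.trans_lt ?_
    rwa [mul_comm, ← lt_div_iff₀ (by positivity), one_div]
  · nlinarith [mul_le_mul_of_nonneg_left (hexp u hu.2) (mul_nonneg hBpos.le he0)]

theorem IsSemiflow.differentiable [FiniteDimensional ℝ V] (hG : IsC1Field G)
    (hΦ : IsSemiflow G T Φ) {s t : ℝ} (hs : s ∈ Icc 0 T) (ht : t ∈ Icc s T) :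
    Differentiable ℝ (Φ s t) := by
  intro v₀
  have : ProperSpace V := FiniteDimensional.proper ℝ V
  have : CompleteSpace V := FiniteDimensional.complete ℝ V
  have hsub : Icc s T ⊆ Icc 0 T := Icc_subset_Icc_left hs.1
  have hs' : s ∈ Icc s T := ⟨le_rfl, hs.2⟩
  have hT0 : 0 ≤ T := hs.1.trans hs.2
  obtain ⟨R, hR⟩ := hΦ.exists_bound hs v₀
  obtain ⟨C, hC, δ₀, hδ₀, hLip⟩ := hΦ.exists_lipschitz hG R
  have hB : ContinuousOn (fun r => fderiv ℝ (G r) (Φ s r v₀)) (Icc s T) :=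
    hG.cont_fderiv.comp_continuousOn (continuousOn_id.prodMk (hΦ.cont s hs v₀))
  obtain ⟨K₀, hK₀⟩ := isCompact_Icc.exists_bound_of_continuousOn hB
  obtain ⟨K, hK, hKB⟩ : ∃ K > 0, ∀ r ∈ Icc s T, ‖fderiv ℝ (G r) (Φ s r v₀)‖ ≤ K :=
    ⟨max K₀ 1, by positivity, fun r hr => (hK₀ r hr).trans (le_max_left _ _)⟩
  set D : ℝ → V → V := fun u h => Φ s u (v₀ + h) - Φ s u v₀ with hD
  have hDc : ∀ h, ContinuousOn (fun u => D u h) (Icc s T) := fun h =>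
    (hΦ.cont s hs _).sub (hΦ.cont s hs _)
  have hDb : ∀ h, ‖h‖ < δ₀ → ∀ u ∈ Icc s T, ‖D u h‖ ≤ C * ‖h‖ := fun h hh u hu => by
    simpa using hLip s hs v₀ hR (v₀ + h) (by simpa using hh) u hu
  -- the linearization error along the trajectory
  set ρ : ℝ → V → V := fun r h => G r (Φ s r (v₀ + h)) - G r (Φ s r v₀) -
    fderiv ℝ (G r) (Φ s r v₀) (D r h) with hρ
  have hρc : ∀ h, ContinuousOn (fun r => ρ r h) (Icc s T) := fun h =>
    ((hG.continuousOn_comp (hΦ.cont s hs _)).sub (hG.continuousOn_comp (hΦ.cont s hs _))).sub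
      (hB.clm_apply (hDc h))
  have hBD : ∀ h, ContinuousOn (fun r => fderiv ℝ (G r) (Φ s r v₀) (D r h)) (Icc s T) :=
    fun h => hB.clm_apply (hDc h)
  have hint : ∀ {f : ℝ → V}, ContinuousOn f (Icc s T) → ∀ u ∈ Icc s T,
      IntervalIntegrable f volume s u := fun hf u hu =>
    (hf.mono (uIcc_subset_Icc hs' hu)).intervalIntegrable
  have hcomb : ∀ {f₁ f₂ f₃ : ℝ → V}, ContinuousOn f₁ (Icc s T) → ContinuousOn f₂ (Icc s T) →
      ContinuousOn f₃ (Icc s T) → ∀ a b : ℝ, ∀ u ∈ Icc s T,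
      ∫ r in s..u, (f₁ r - a • f₂ r - b • f₃ r) =
        (∫ r in s..u, f₁ r) - a • (∫ r in s..u, f₂ r) - b • ∫ r in s..u, f₃ r := by
    intro f₁ f₂ f₃ h₁ h₂ h₃ a b u hu
    have i₁₂ : IntervalIntegrable (fun r => f₁ r - a • f₂ r) volume s u :=
      hint (h₁.sub (h₂.const_smul a)) u hu
    have i₂ : IntervalIntegrable (fun r => a • f₂ r) volume s u := hint (h₂.const_smul a) u hu
    have i₃ : IntervalIntegrable (fun r => b • f₃ r) volume s u := hint (h₃.const_smul b) u hu
    rw [intervalIntegral.integral_sub i₁₂ i₃, intervalIntegral.integral_sub (hint h₁ u hu) i₂,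
      intervalIntegral.integral_smul, intervalIntegral.integral_smul]
  have hDeq : ∀ h, ∀ u ∈ Icc s T, D u h = h +
      ((∫ r in s..u, fderiv ℝ (G r) (Φ s r v₀) (D r h)) + ∫ r in s..u, ρ r h) := by
    intro h u hu
    rw [← intervalIntegral.integral_add (hint (hBD h) u hu) (hint (hρc h) u hu)]
    simp only [hρ, add_sub_cancel]
    rw [intervalIntegral.integral_sub (hΦ.intervalIntegrable hG hs _ hs' hu)
      (hΦ.intervalIntegrable hG hs _ hs' hu)]
    simp only [hD]
    rw [hΦ.eq s hs (v₀ + h) u hu, hΦ.eq s hs v₀ u hu]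
    abel
  have key : DifferentiableAt ℝ (D t) 0 := by
    apply differentiableAt_zero_of_approx_linear
    intro η hη
    set Q := 2 * C * T * Real.exp (K * T) + 1 with hQ
    have hQ0 : 0 < Q := by positivity
    obtain ⟨δ₁, hδ₁, hlin⟩ := hG.exists_linearization T R (η := η / Q) (by positivity)
    refine ⟨min δ₀ (δ₁ / C), by positivity, fun h k a b hh hk hl => ?_⟩
    set l := a • h + b • k with hl_def
    set S := |a| * ‖h‖ + |b| * ‖k‖ with hS
    have hS0 : 0 ≤ S := by positivity
    have hlS : ‖l‖ ≤ S := by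
      refine (norm_add_le _ _).trans (le_of_eq ?_)
      rw [norm_smul, norm_smul, Real.norm_eq_abs, Real.norm_eq_abs]
    have hρb : ∀ h, ‖h‖ < min δ₀ (δ₁ / C) → ∀ r ∈ Icc s T, ‖ρ r h‖ ≤ η / Q * (C * ‖h‖) := by
      intro h hh r hr
      have h1 := hDb h (hh.trans_le (min_le_left _ _)) r hr
      have h2 : C * ‖h‖ ≤ δ₁ := by
        rw [mul_comm, ← le_div_iff₀ hC]; exact (hh.trans_le (min_le_right _ _)).le
      have h3 := hlin r (hsub hr) (Φ s r v₀) (by simpa using hR r hr) (D r h) (h1.trans h2)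
      have h4 : Φ s r v₀ + D r h = Φ s r (v₀ + h) := by simp [hD]
      rw [h4] at h3
      exact h3.trans (mul_le_mul_of_nonneg_left h1 (by positivity))
    set P : ℝ → V := fun u => D u l - a • D u h - b • D u k with hP
    have hPc : ContinuousOn P (Icc s T) :=
      ((hDc l).sub ((hDc h).const_smul a)).sub ((hDc k).const_smul b)
    set σ : ℝ → V := fun r => ρ r l - a • ρ r h - b • ρ r k with hσ
    have hPeq : ∀ u ∈ Icc s T, P u = (∫ r in s..u, fderiv ℝ (G r) (Φ s r v₀) (P r)) +
        ∫ r in s..u, σ r := by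
      intro u hu
      simp only [hP, hσ, map_sub, map_smul]
      rw [hcomb (hBD l) (hBD h) (hBD k) a b u hu, hcomb (hρc l) (hρc h) (hρc k) a b u hu]
      rw [hDeq l u hu, hDeq h u hu, hDeq k u hu, hl_def]
      module
    have hσb : ∀ r ∈ Icc s T, ‖σ r‖ ≤ η / Q * (2 * C * S) := by
      intro r hr
      calc ‖σ r‖ ≤ ‖ρ r l‖ + ‖a • ρ r h‖ + ‖b • ρ r k‖ :=
            (norm_sub_le _ _).trans (add_le_add_left (norm_sub_le _ _) _)
        _ ≤ η / Q * (C * ‖l‖) + |a| * (η / Q * (C * ‖h‖)) + |b| * (η / Q * (C * ‖k‖)) := by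
            rw [norm_smul, norm_smul, Real.norm_eq_abs, Real.norm_eq_abs]
            gcongr
            exacts [hρb l hl r hr, hρb h hh r hr, hρb k hk r hr]
        _ ≤ η / Q * (C * S) + η / Q * (C * S) := by
            have : η / Q * (C * ‖l‖) ≤ η / Q * (C * S) := by gcongr
            rw [hS] at *
            linarith
        _ = _ := by ring
    let d : ℝ → ℝ := IccExtend hs.2 ((Icc s T).domRestrict fun u => ‖P u‖)
    have hd : Continuous d := hPc.norm.domRestrict.Icc_extend'
    have hdeq : ∀ u ∈ Icc s T, d u = ‖P u‖ := fun u hu => by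
      simp only [d, IccExtend_of_mem _ _ hu, domRestrict_apply]
    have hgr := le_mul_exp_of_le_add_mul_integral (a := s) (b := T)
      (ε := η / Q * (2 * C * S) * T) hK hd (fun u hu => ?_) t ht
    · rw [hdeq t ht] at hgr
      refine hgr.trans ?_
      calc η / Q * (2 * C * S) * T * Real.exp (K * (t - s))
          ≤ η / Q * (2 * C * S) * T * Real.exp (K * T) := by
            gcongr; linarith [hs.1, ht.2]
        _ = η * S * ((2 * C * T * Real.exp (K * T)) / Q) := by ring
        _ ≤ η * S * 1 := by
            gcongr
            rw [div_le_one hQ0]; linarith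
        _ = η * S := mul_one _
    · rw [hdeq u hu, hPeq u hu, ← intervalIntegral.integral_const_mul, add_comm]
      refine (norm_add_le _ _).trans (add_le_add ?_ ?_)
      · refine (intervalIntegral.norm_integral_le_of_norm_le_const fun r hr =>
          hσb r ?_).trans ?_
        · rw [uIoc_of_le hu.1] at hr
          exact ⟨hr.1.le, hr.2.trans hu.2⟩
        · rw [abs_of_nonneg (by linarith [hu.1])]
          gcongr
          linarith [hs.1, hu.2]
      · refine intervalIntegral.norm_integral_le_of_norm_le hu.1 ?_
          ((hd.const_mul K).intervalIntegrable _ _)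
        refine Filter.Eventually.of_forall fun r hr => ?_
        have hr' : r ∈ Icc s T := ⟨hr.1.le, hr.2.trans hu.2⟩
        rw [hdeq r hr']
        exact (ContinuousLinearMap.le_opNorm _ _).trans
          (mul_le_mul_of_nonneg_right (hKB r hr') (norm_nonneg _))
  have h1 : DifferentiableAt ℝ (fun v => D t (v - v₀)) v₀ :=
    DifferentiableAt.fun_comp' (f := fun v => v - v₀) v₀ (by simpa using key)
      (differentiableAt_id.sub_const v₀)
  have h2 : Φ s t = fun v => D t (v - v₀) + Φ s t v₀ := by
    funext v; simp [hD]
  rw [h2]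
  exact h1.add_const _

/-- **Fundamental theorem of calculus** for a continuous function with a left derivative. -/
theorem integral_eq_sub_of_hasDeriv_left_of_le [CompleteSpace V] {f f' : ℝ → V} {a b : ℝ}
    (hab : a ≤ b) (hcont : ContinuousOn f (Icc a b))
    (hderiv : ∀ x ∈ Ioo a b, HasDerivWithinAt f (f' x) (Iio x) x)
    (hint : IntervalIntegrable f' volume a b) : ∫ y in a..b, f' y = f b - f a := by
  have key := intervalIntegral.integral_eq_sub_of_hasDeriv_right_of_le (neg_le_neg hab)
    (f := fun x => f (-x)) (f' := fun x => -f' (-x))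
    (hcont.comp continuous_neg.continuousOn fun x hx => ⟨by linarith [hx.2], by linarith [hx.1]⟩)
    (fun x hx => by
      have h1 := hderiv (-x) ⟨by linarith [hx.2], by linarith [hx.1]⟩
      have h2 := h1.scomp x (hasDerivAt_neg x).hasDerivWithinAt (s := Ioi x)
        (fun y hy => by simpa using hy)
      simpa [Function.comp_def] using h2)
    (by simpa [Pi.neg_def, div_neg] using (hint.comp_mul_left (c := -1)).symm.neg)
  rw [intervalIntegral.integral_neg, intervalIntegral.integral_comp_neg (f := f')] at key
  simp only [neg_neg] at key
  rw [← neg_inj, key]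
  abel

/-- A left derivative of a continuous function on `[0, t]` is measurable. -/
theorem measurable_of_hasDerivWithinAt_Icc [MeasurableSpace V] [BorelSpace V]
    {f f' : ℝ → V} {t : ℝ} (ht : 0 ≤ t) (hcont : ContinuousOn f (Icc 0 t))
    (hderiv : ∀ x ∈ Ioc 0 t, HasDerivWithinAt f (f' x) (Icc 0 x) x) :
    Measurable fun s : Icc 0 t => f' s := by
  let fe : ℝ → V := IccExtend ht ((Icc 0 t).domRestrict f)
  have hfe : Continuous fe := hcont.domRestrict.Icc_extend'
  have hfeq : ∀ u ∈ Icc 0 t, fe u = f u := fun u hu => by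
    simp only [fe, IccExtend_of_mem _ _ hu, domRestrict_apply]
  let ε : ℕ → ℝ := fun n => 1 / ((n : ℝ) + 1)
  have hε : Tendsto ε atTop (𝓝 0) := tendsto_one_div_add_atTop_nhds_zero_nat
  have hεpos : ∀ n, 0 < ε n := fun n => by positivity
  classical
  refine measurable_of_tendsto_metrizable (f := fun n (s : Icc 0 t) =>
    if (s : ℝ) = 0 then f' 0 else (ε n)⁻¹ • (fe s - fe (s - ε n))) (fun n => ?_) ?_
  · refine Measurable.ite (measurable_subtype_coe (measurableSet_singleton 0)) measurable_const ?_
    have : Continuous fun s : Icc 0 t => (ε n)⁻¹ • (fe s - fe (s - ε n)) := by fun_prop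
    exact this.measurable
  · rw [tendsto_pi_nhds]
    rintro ⟨s, hs⟩
    by_cases h0 : s = 0
    · simp [h0]
    simp only [h0, if_false]
    have hs0 : 0 < s := lt_of_le_of_ne hs.1 (Ne.symm h0)
    have h1 := (hasDerivWithinAt_iff_tendsto_slope.1 (hderiv s ⟨hs0, hs.2⟩))
    have hev : ∀ᶠ n in atTop, ε n < s := hε.eventually_lt_const hs0
    have h2 : Tendsto (fun n => s - ε n) atTop (𝓝[Icc 0 s \ {s}] s) := by
      refine tendsto_nhdsWithin_iff.2 ⟨by simpa using hε.const_sub s, ?_⟩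
      filter_upwards [hev] with n hn
      exact ⟨⟨by linarith, by linarith [hεpos n]⟩, by simp [(hεpos n).ne']⟩
    refine (h1.comp h2).congr' ?_
    filter_upwards [hev] with n hn
    simp only [Function.comp, slope, vsub_eq_sub]
    rw [hfeq s hs, hfeq (s - ε n) ⟨by linarith, by linarith [hεpos n, hs.2]⟩, sub_sub_cancel_left,
      inv_neg, neg_smul, ← smul_neg, neg_sub]

/-- The left derivative of `s ↦ Φ s t (w s)` along a perturbed trajectory `w`. -/
theorem IsSemiflow.hasDerivWithinAt_comp [FiniteDimensional ℝ V] (hG : IsC1Field G)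
    (hΦ : IsSemiflow G T Φ) {w : ℝ → V} {w' : V} {s t : ℝ} (hs : s ∈ Ioc 0 t) (ht : t ≤ T)
    (hw : HasDerivWithinAt w w' (Icc 0 s) s) :
    HasDerivWithinAt (fun r => Φ r t (w r)) (fderiv ℝ (Φ s t) (w s) (w' - G s (w s)))
      (Icc 0 s) s := by
  have : ProperSpace V := FiniteDimensional.proper ℝ V
  have hsT : s ∈ Icc 0 T := ⟨hs.1.le, hs.2.trans ht⟩
  have hss : s ∈ Icc 0 s := ⟨hs.1.le, le_rfl⟩
  have hmem : ∀ r ∈ Icc 0 s, r ∈ Icc 0 T := fun r hr => ⟨hr.1, hr.2.trans hsT.2⟩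
  obtain ⟨φ, -, -, hφ, C, hC, δ, hδ, hsh⟩ := hΦ.exists_shadow hG hsT (w s)
  have hq : HasDerivWithinAt (fun r => ∫ u in r..s, G u (Φ r u (w r))) (-G s (w s))
      (Icc 0 s) s := by
    refine HasDerivWithinAt.of_isLittleO ?_
    rw [Asymptotics.isLittleO_iff]
    intro η hη
    have hGc := Metric.continuous_iff.1 hG.cont (s, w s) η hη
    obtain ⟨κ, hκ, hGκ⟩ := hGc
    have hlim : Tendsto (fun r => ‖w r - w s‖ + |r - s|) (𝓝[Icc 0 s] s) (𝓝 0) := by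
      have h1 : Tendsto (fun r => ‖w r - w s‖ + |r - s|) (𝓝[Icc 0 s] s)
          (𝓝 (‖w s - w s‖ + |s - s|)) :=
        ((hw.continuousWithinAt.sub continuousWithinAt_const).norm.add
          ((continuousWithinAt_id.sub continuousWithinAt_const).abs))
      simpa using h1
    filter_upwards [hlim.eventually_lt_const hδ,
      hlim.eventually_lt_const (show 0 < κ / C by positivity),
      hlim.eventually_lt_const hκ, self_mem_nhdsWithin] with r h1 h2 h3 hr
    have hI : IntervalIntegrable (fun u => G u (Φ r u (w r))) volume r s :=
      hΦ.intervalIntegrable hG (hmem r hr) _ ⟨le_rfl, (hmem r hr).2⟩ ⟨hr.2, hsT.2⟩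
    have hid : (∫ u in r..s, G u (Φ r u (w r))) - (∫ u in s..s, G u (Φ s u (w s)))
        - (r - s) • (-G s (w s)) = ∫ u in r..s, (G u (Φ r u (w r)) - G s (w s)) := by
      rw [intervalIntegral.integral_sub hI (by simp), intervalIntegral.integral_same,
        intervalIntegral.integral_const]
      module
    rw [hid, Real.norm_eq_abs, abs_sub_comm]
    refine intervalIntegral.norm_integral_le_of_norm_le_const fun u hu => ?_
    rw [uIoc_of_le hr.2] at hu
    have h4 := hsh r (hmem r hr) (w r) h1 u ⟨hu.1.le, hu.2.trans hsT.2⟩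
    rw [hφ u hu.2] at h4
    rw [← dist_eq_norm]
    refine (hGκ (u, Φ r u (w r)) ?_).le
    rw [Prod.dist_eq, max_lt_iff]
    constructor
    · rw [Real.dist_eq, abs_of_nonpos (by linarith [hu.2])]
      have := neg_abs_le (r - s)
      have := norm_nonneg (w r - w s)
      simp only; linarith [hu.1]
    · rw [dist_eq_norm]
      refine h4.trans_lt ?_
      rwa [mul_comm, ← lt_div_iff₀ hC]
  have hp : HasDerivWithinAt (fun r => Φ r s (w r)) (w' - G s (w s)) (Icc 0 s) s := by
    refine (sub_eq_add_neg w' (G s (w s)) ▸ hw.add hq).congr (fun r hr => ?_) ?_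
    · exact hΦ.eq r (hmem r hr) (w r) s ⟨hr.2, hsT.2⟩
    · exact hΦ.eq s hsT (w s) s ⟨le_rfl, hsT.2⟩
  have hdiff : HasFDerivAt (Φ s t) (fderiv ℝ (Φ s t) (w s)) (Φ s s (w s)) := by
    rw [hΦ.self hsT]
    exact (hΦ.differentiable hG hsT ⟨hs.2, ht⟩ (w s)).hasFDerivAt
  refine (hdiff.comp_hasDerivWithinAt s hp).congr (fun r hr => ?_) ?_
  · exact (hΦ.comp hG (hmem r hr) ⟨hr.2, hsT.2⟩ ⟨hs.2, ht⟩ (w r)).symm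
  · exact (hΦ.comp hG hsT ⟨le_rfl, hsT.2⟩ ⟨hs.2, ht⟩ (w s)).symm

theorem IsSemiflow.continuousOn_comp [ProperSpace V] (hG : IsC1Field G)
    (hΦ : IsSemiflow G T Φ) {w : ℝ → V} (hw : ContinuousOn w (Icc 0 T)) {t : ℝ} (ht : t ≤ T) :
    ContinuousOn (fun r => Φ r t (w r)) (Icc 0 t) := by
  intro s hs
  have hsub : Icc 0 t ⊆ Icc 0 T := Icc_subset_Icc_right ht
  obtain ⟨φ, -, hφ, -, C, hC, δ, hδ, hsh⟩ := hΦ.exists_shadow hG (hsub hs) (w s)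
  have hlim : Tendsto (fun r => ‖w r - w s‖ + |r - s|) (𝓝[Icc 0 t] s) (𝓝 0) := by
    have h1 : Tendsto (fun r => ‖w r - w s‖ + |r - s|) (𝓝[Icc 0 t] s)
        (𝓝 (‖w s - w s‖ + |s - s|)) :=
      ((((hw s (hsub hs)).mono hsub).sub continuousWithinAt_const).norm.add
        ((continuousWithinAt_id.sub continuousWithinAt_const).abs))
    simpa using h1
  rw [ContinuousWithinAt, tendsto_iff_norm_sub_tendsto_zero]
  refine squeeze_zero' (Eventually.of_forall fun _ => norm_nonneg _) ?_
    (by simpa using hlim.const_mul C)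
  filter_upwards [hlim.eventually_lt_const hδ, self_mem_nhdsWithin] with r h1 hr
  rw [← hφ t ⟨hs.2, ht⟩]
  exact hsh r (hsub hr) (w r) h1 t ⟨hr.2, ht⟩

theorem IsSemiflow.exists_fderiv_bound [FiniteDimensional ℝ V] (hG : IsC1Field G)
    (hΦ : IsSemiflow G T Φ) {w : ℝ → V} (hw : ContinuousOn w (Icc 0 T)) :
    ∃ C, ∀ s ∈ Icc 0 T, ∀ t ∈ Icc s T, ‖fderiv ℝ (Φ s t) (w s)‖ ≤ C := by
  have : ProperSpace V := FiniteDimensional.proper ℝ V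
  -- the trajectories issued from `w s` are uniformly bounded
  have hR : ∃ R, ∀ s ∈ Icc 0 T, ∀ u ∈ Icc s T, ‖Φ s u (w s)‖ ≤ R := by
    refine isCompact_Icc.induction_on (p := fun S : Set ℝ => ∃ R, ∀ s ∈ Icc 0 T, s ∈ S →
      ∀ u ∈ Icc s T, ‖Φ s u (w s)‖ ≤ R) (s := Icc 0 T) ⟨0, by simp⟩ ?_ ?_ ?_ |>.imp
      fun R h s hs => h s hs hs
    · rintro S S' hS ⟨R, h⟩
      exact ⟨R, fun s hs hsS => h s hs (hS hsS)⟩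
    · rintro S S' ⟨R, h⟩ ⟨R', h'⟩
      refine ⟨max R R', fun s hs hsS u hu => ?_⟩
      rcases hsS with hsS | hsS
      · exact (h s hs hsS u hu).trans (le_max_left _ _)
      · exact (h' s hs hsS u hu).trans (le_max_right _ _)
    · intro s hs
      obtain ⟨φ, hφc, -, -, C, hC, δ, hδ, hsh⟩ := hΦ.exists_shadow hG hs (w s)
      obtain ⟨R, hR⟩ := isCompact_Icc (a := (0 : ℝ)) (b := T) |>.exists_bound_of_continuousOn
        hφc.continuousOn
      have hlim : Tendsto (fun r => ‖w r - w s‖ + |r - s|) (𝓝[Icc 0 T] s) (𝓝 0) := by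
        have h1 : Tendsto (fun r => ‖w r - w s‖ + |r - s|) (𝓝[Icc 0 T] s)
            (𝓝 (‖w s - w s‖ + |s - s|)) :=
          (((hw s hs).sub continuousWithinAt_const).norm.add
            ((continuousWithinAt_id.sub continuousWithinAt_const).abs))
        simpa using h1
      refine ⟨_, hlim.eventually_lt_const hδ, C * δ + R, fun r hr hr' u hu => ?_⟩
      have h1 := hsh r hr (w r) hr' u hu
      have h2 := hR u ⟨hr.1.trans hu.1, hu.2⟩
      have h3 := norm_add_le (Φ r u (w r) - φ u) (φ u)
      rw [sub_add_cancel] at h3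
      have h4 := mul_le_mul_of_nonneg_left (le_of_lt hr') hC.le
      linarith
  obtain ⟨R, hR⟩ := hR
  obtain ⟨C, hC, δ, hδ, h⟩ := hΦ.exists_lipschitz hG R
  refine ⟨C, fun s hs t ht => ?_⟩
  refine (hΦ.differentiable hG hs ht (w s)).hasFDerivAt.le_of_lip' hC.le ?_
  filter_upwards [Metric.ball_mem_nhds (w s) hδ] with v hv
  exact h s hs (w s) (hR s hs) v (by simpa [dist_eq_norm] using hv) t ht

/-- **Alekseev–Gröbner formula** for a perturbed trajectory with left-continuous velocity. -/
theorem IsSemiflow.alekseev_groebner [FiniteDimensional ℝ V] [MeasurableSpace V] [BorelSpace V]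
    (hG : IsC1Field G) (hΦ : IsSemiflow G T Φ) {w g : ℝ → V} (hgm : StronglyMeasurable g)
    (hgb : ∃ M, ∀ s, ‖g s‖ ≤ M) (hgl : ∀ s ∈ Ioc 0 T, ContinuousWithinAt g (Iic s) s)
    (hw : ∀ t ∈ Icc 0 T, w t = w 0 + ∫ s in (0 : ℝ)..t, g s) {t : ℝ} (ht : t ∈ Icc 0 T) :
    (Measurable fun s : Icc 0 t => fderiv ℝ (Φ s t) (w s) (g s - G s (w s))) ∧
    (∃ C, ∀ s ∈ Icc 0 t, ‖fderiv ℝ (Φ s t) (w s) (g s - G s (w s))‖ ≤ C) ∧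
    IntervalIntegrable (fun s => fderiv ℝ (Φ s t) (w s) (g s - G s (w s))) volume 0 t ∧
    ∫ s in (0 : ℝ)..t, fderiv ℝ (Φ s t) (w s) (g s - G s (w s)) = w t - Φ 0 t (w 0) := by
  have : ProperSpace V := FiniteDimensional.proper ℝ V
  have : CompleteSpace V := FiniteDimensional.complete ℝ V
  obtain ⟨M, hM⟩ := hgb
  have hgi : ∀ a b, IntervalIntegrable g volume a b := fun a b =>
    (intervalIntegrable_const (c := M)).mono_fun hgm.aestronglyMeasurable
      (Eventually.of_forall fun s => (hM s).trans (le_abs_self M))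
  have hwc : ContinuousOn w (Icc 0 T) :=
    (continuous_const.add (intervalIntegral.continuous_primitive hgi 0)).continuousOn.congr hw
  have hwd : ∀ s ∈ Ioc 0 T, HasDerivWithinAt w (g s) (Icc 0 s) s := fun s hs =>
    (((intervalIntegral.integral_hasDerivWithinAt_right (s := Iic s) (t := Iic s) (hgi 0 s)
      (hgm.stronglyMeasurableAtFilter) (hgl s hs)).const_add (w 0)).mono Icc_subset_Iic_self).congr
      (fun r hr => hw r ⟨hr.1, hr.2.trans hs.2⟩) (hw s ⟨hs.1.le, hs.2⟩)
  have hWc := hΦ.continuousOn_comp hG hwc ht.2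
  have hWd : ∀ s ∈ Ioc 0 t, HasDerivWithinAt (fun r => Φ r t (w r))
      (fderiv ℝ (Φ s t) (w s) (g s - G s (w s))) (Icc 0 s) s := fun s hs =>
    hΦ.hasDerivWithinAt_comp hG hs ht.2 (hwd s ⟨hs.1, hs.2.trans ht.2⟩)
  have hmeas : Measurable fun s : Icc 0 t => fderiv ℝ (Φ s t) (w s) (g s - G s (w s)) :=
    measurable_of_hasDerivWithinAt_Icc
      (f' := fun s => fderiv ℝ (Φ s t) (w s) (g s - G s (w s))) ht.1 hWc hWd
  have hbd : ∃ C, ∀ s ∈ Icc 0 t, ‖fderiv ℝ (Φ s t) (w s) (g s - G s (w s))‖ ≤ C := by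
    obtain ⟨C, hC⟩ := hΦ.exists_fderiv_bound hG hwc
    obtain ⟨N, hN⟩ := isCompact_Icc.exists_bound_of_continuousOn (hG.continuousOn_comp hwc)
    refine ⟨C * (M + N), fun s hs => ?_⟩
    have hsT : s ∈ Icc 0 T := ⟨hs.1, hs.2.trans ht.2⟩
    have h1 := hC s hsT t ⟨hs.2, ht.2⟩
    exact (ContinuousLinearMap.le_opNorm _ _).trans (mul_le_mul h1
      ((norm_sub_le _ _).trans (add_le_add (hM s) (hN s hsT))) (norm_nonneg _)
      ((norm_nonneg _).trans h1))
  refine ⟨hmeas, hbd, ?_⟩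
  obtain ⟨C, hC⟩ := hbd
  have hint : IntervalIntegrable (fun s => fderiv ℝ (Φ s t) (w s) (g s - G s (w s)))
      volume 0 t := by
    rw [intervalIntegrable_iff_integrableOn_Icc_of_le ht.1]
    have haem : AEMeasurable (fun s => fderiv ℝ (Φ s t) (w s) (g s - G s (w s)))
        (volume.restrict (Icc 0 t)) :=
      (aemeasurable_restrict_iff_comap_subtype measurableSet_Icc).2 hmeas.aemeasurable
    exact IntegrableOn.of_bound (by simp) haem.aestronglyMeasurable C
      ((ae_restrict_mem measurableSet_Icc).mono hC)
  refine ⟨hint, ?_⟩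
  rw [integral_eq_sub_of_hasDeriv_left_of_le ht.1 hWc (fun s hs => ?_) hint, hΦ.self ht]
  have hnhds : Icc 0 s ∈ 𝓝[Iio s] s :=
    mem_of_superset (Ico_mem_nhdsLT hs.1) Ico_subset_Icc_self
  exact (hWd s ⟨hs.1, hs.2.le⟩).mono_of_mem_nhdsWithin hnhds

end Flow

/-- The semigroup generated by an operator which is diagonal in an orthonormal basis. -/
theorem exists_diagonal_semigroup {H : Type*} [NormedAddCommGroup H] [InnerProductSpace ℝ H]
    {ι : Type*} [Fintype ι] (b : OrthonormalBasis ι ℝ H) (lam : ι → ℝ) :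
    ∃ S : ℝ → H →L[ℝ] H, (∀ t v, S t v = ∑ i, (Real.exp (t * lam i) * ⟪b i, v⟫) • b i) ∧
      Continuous S ∧ (∀ v, S 0 v = v) ∧ ∀ s t v, S s (S t v) = S (s + t) v := by
  have hS : ∀ (t : ℝ) (v : H), (∑ i, Real.exp (t * lam i) •
      (innerSL ℝ (b i)).smulRight (b i) : H →L[ℝ] H) v
        = ∑ i, (Real.exp (t * lam i) * ⟪b i, v⟫) • b i := fun t v => by
    simp [smul_smul]
  refine ⟨fun t => ∑ i, Real.exp (t * lam i) • (innerSL ℝ (b i)).smulRight (b i), hS,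
    by fun_prop, fun v => ?_, fun s t v => ?_⟩
  · rw [hS]
    simpa using b.sum_repr' v
  · rw [hS, hS, hS]
    refine Finset.sum_congr rfl fun i _ => ?_
    congr 1
    rw [b.orthonormal.inner_right_fintype, add_mul, Real.exp_add]
    ring

theorem isC1Field_conj {V : Type*} [NormedAddCommGroup V] [NormedSpace ℝ V]
    {S : ℝ → V →L[ℝ] V} (hS : Continuous S) {o : ℝ → V} (ho : Continuous o) {F : V → V}
    (hF : ContDiff ℝ 1 F) : IsC1Field fun t v => S (-t) (F (S t v + o t)) := by
  have hd : ∀ t v, HasFDerivAt (fun v => S (-t) (F (S t v + o t)))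
      ((S (-t)).comp ((fderiv ℝ F (S t v + o t)).comp (S t))) v := fun t v =>
    (S (-t)).hasFDerivAt.comp v (((hF.differentiable one_ne_zero _).hasFDerivAt).comp v
      ((S t).hasFDerivAt.add_const (o t)))
  have hin : Continuous fun p : ℝ × V => S p.1 p.2 + o p.1 :=
    ((hS.comp continuous_fst).clm_apply continuous_snd).add (ho.comp continuous_fst)
  have hneg : Continuous fun p : ℝ × V => S (-p.1) := hS.comp continuous_fst.neg
  refine ⟨hneg.clm_apply (hF.continuous.comp hin), fun t v => (hd t v).differentiableAt, ?_⟩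
  simp only [(hd _ _).fderiv]
  exact hneg.clm_comp (((hF.continuous_fderiv one_ne_zero).comp hin).clm_comp
    (hS.comp continuous_fst))

/-- A function of the last grid point before `s` is bounded, strongly measurable and
left-continuous after a constant extension to the real line. -/
theorem exists_leftContinuous_step {V : Type*} [NormedAddCommGroup V] {T : ℝ} (hT : 0 < T)
    {θ : Finset ℝ} (hθ0 : (0 : ℝ) ∈ θ) (hθsub : ∀ x ∈ θ, x ∈ Icc 0 T) {lfl : ℝ → ℝ}
    (hlfl0 : lfl 0 = 0) (hlfl : ∀ t : ℝ, 0 < t → IsGreatest {x : ℝ | x ∈ θ ∧ x < t} (lfl t))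
    (κ : ℝ → V) :
    ∃ g : ℝ → V, (∀ s ∈ Icc 0 T, g s = κ (lfl s)) ∧ StronglyMeasurable g ∧
      (∃ M, ∀ s, ‖g s‖ ≤ M) ∧ ∀ s ∈ Ioc 0 T, ContinuousWithinAt g (Iic s) s := by
  have hmem : ∀ s : ℝ, 0 ≤ s → lfl s ∈ θ := fun s hs => by
    rcases hs.eq_or_lt with rfl | h
    · rwa [hlfl0]
    · exact (hlfl s h).1.1
  have hmono : ∀ r s : ℝ, 0 ≤ r → r ≤ s → lfl r ≤ lfl s := fun r s hr hrs => by
    rcases hr.eq_or_lt with rfl | h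
    · rw [hlfl0]; exact (hθsub _ (hmem s hrs)).1
    · exact (hlfl s (h.trans_le hrs)).2 ⟨(hlfl r h).1.1, (hlfl r h).1.2.trans_le hrs⟩
  let ℓ : ℝ → θ := fun s => ⟨lfl (projIcc 0 T hT.le s), hmem _ (projIcc 0 T hT.le s).2.1⟩
  have hℓ : Measurable ℓ := by
    refine Measurable.subtype_mk (Monotone.measurable fun r s hrs => ?_)
    exact hmono _ _ (projIcc 0 T hT.le r).2.1 (monotone_projIcc hT.le hrs)
  have hg : ∀ s ∈ Icc 0 T, κ (ℓ s) = κ (lfl s) := fun s hs => by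
    simp only [ℓ, projIcc_of_mem _ hs]
  refine ⟨fun s => κ (ℓ s), hg, ?_, ⟨∑ p ∈ θ, ‖κ p‖, fun s =>
    Finset.single_le_sum (f := fun p => ‖κ p‖) (fun _ _ => norm_nonneg _) (ℓ s).2⟩, ?_⟩
  · have : StronglyMeasurable fun p : θ => κ p := StronglyMeasurable.of_discrete
    exact this.comp_measurable hℓ
  · intro s hs
    have hs' : s ∈ Icc 0 T := ⟨hs.1.le, hs.2⟩
    have hl := hlfl s hs.1
    refine (continuousWithinAt_const (b := κ (lfl s))).congr_of_eventuallyEq ?_ (hg s hs')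
    filter_upwards [Ioc_mem_nhdsLE hl.1.2] with r hr
    have h0 : 0 < r := lt_of_le_of_lt (hθsub _ hl.1.1).1 hr.1
    rw [hg r ⟨h0.le, hr.2.trans hs.2⟩]
    congr 1
    exact le_antisymm (hmono r s h0.le hr.2) ((hlfl r h0).2 ⟨hl.1.1, hr.1⟩)

end Helpers

/-- In the setting of Statement 1: for every `t ∈ [0,T]`,
(a) the map `s ↦ ∂_x X_{s,t}^{𝕪_s − 𝕆_s + O_s}( e^{(s−⌊s⌋_θ)A} 𝕗(𝕪_{⌊s⌋_θ}) −
F(𝕪_s − 𝕆_s + O_s) )` is Borel measurable on `[0,t]`;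
(b) the integral of its norm over `[0,t]` is finite; and
(c) `𝕪_t − X_{0,t}^{ξ+O_0} = 𝕆_t − O_t + ∫_0^t ∂_x X_{s,t}^{𝕪_s − 𝕆_s + O_s}(
e^{(s−⌊s⌋_θ)A} 𝕗(𝕪_{⌊s⌋_θ}) − F(𝕪_s − 𝕆_s + O_s) ) ds`. -/
theorem stmt_2
    {H : Type*} [NormedAddCommGroup H] [InnerProductSpace ℝ H]
    [FiniteDimensional ℝ H] [Nontrivial H] [MeasurableSpace H] [BorelSpace H]
    {ι : Type*} [Fintype ι] (b : OrthonormalBasis ι ℝ H)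
    (lam : ι → ℝ) (hlam : ∀ i, lam i < 0)
    (E : ℝ → H → H)
    (hE : ∀ t v, E t v = ∑ i, (Real.exp (t * lam i) * ⟪b i, v⟫) • b i)
    (T : ℝ) (hT : 0 < T)
    (θ : Finset ℝ) (hθ0 : (0 : ℝ) ∈ θ) (hθT : T ∈ θ)
    (hθsub : ∀ x ∈ θ, x ∈ Set.Icc (0 : ℝ) T)
    (lfl : ℝ → ℝ) (hlfl0 : lfl 0 = 0)
    (hlfl : ∀ t : ℝ, 0 < t → IsGreatest {x : ℝ | x ∈ θ ∧ x < t} (lfl t))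
    (ξ : H)
    (O : ℝ → H) (hO : ContinuousOn O (Set.Icc (0 : ℝ) T))
    (OO : ℝ → H) (hOO : Measurable fun t : Set.Icc (0 : ℝ) T => OO ↑t)
    (F : H → H) (hF : ContDiff ℝ 1 F)
    (f : H → H)
    (X : ℝ → ℝ → H → H)
    (hXcont : ∀ s ∈ Set.Icc (0 : ℝ) T, ∀ x : H,
      ContinuousOn (fun t => X s t x) (Set.Icc s T))
    (hXeq : ∀ s ∈ Set.Icc (0 : ℝ) T, ∀ x : H, ∀ t ∈ Set.Icc s T,
      X s t x = E (t - s) x + (∫ u in s..t, E (t - u) (F (X s u x))) + O t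
        - E (t - s) (O s))
    (y : ℝ → H)
    (hy : ∀ t ∈ Set.Icc (0 : ℝ) T,
      y t = E t ξ + (∫ u in (0 : ℝ)..t, E (t - lfl u) (f (y (lfl u)))) + OO t) :
    ∀ t ∈ Set.Icc (0 : ℝ) T,
      (Measurable fun s : Set.Icc (0 : ℝ) t =>
        (fderiv ℝ (fun z => X (↑s) t z) (y ↑s - OO ↑s + O ↑s))
          (E ((s : ℝ) - lfl ↑s) (f (y (lfl ↑s))) - F (y ↑s - OO ↑s + O ↑s))) ∧
      (∫⁻ s in Set.Icc (0 : ℝ) t,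
        (‖(fderiv ℝ (fun z => X s t z) (y s - OO s + O s))
            (E (s - lfl s) (f (y (lfl s))) - F (y s - OO s + O s))‖₊ : ℝ≥0∞)) < ⊤ ∧
      y t - X 0 t (ξ + O 0) = OO t - O t +
        ∫ s in (0 : ℝ)..t,
          (fderiv ℝ (fun z => X s t z) (y s - OO s + O s))
            (E (s - lfl s) (f (y (lfl s))) - F (y s - OO s + O s)) := by
  intro t ht
  obtain ⟨S, hSE, hSc, hS0, hSadd⟩ := exists_diagonal_semigroup b lam
  obtain rfl : E = fun t v => S t v := by
    funext t v; rw [hE, hSE]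
  have hSinv : ∀ s v, S s (S (-s) v) = v := fun s v => by rw [hSadd, add_neg_cancel, hS0]
  have hSinv' : ∀ s v, S (-s) (S s v) = v := fun s v => by rw [hSadd, neg_add_cancel, hS0]
  simp only at hXeq hy ⊢
  obtain ⟨o, ho, hoO⟩ : ∃ o : ℝ → H, Continuous o ∧ ∀ s ∈ Icc 0 T, o s = O s :=
    ⟨IccExtend hT.le ((Icc 0 T).domRestrict O), hO.domRestrict.Icc_extend', fun s hs => by
      simp only [IccExtend_of_mem _ _ hs, domRestrict_apply]⟩
  have hG : IsC1Field fun t v => S (-t) (F (S t v + o t)) := isC1Field_conj hSc ho hF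
  set G : ℝ → H → H := fun t v => S (-t) (F (S t v + o t)) with hGdef
  set Φ : ℝ → ℝ → H → H := fun s t v => S (-t) (X s t (S s v + o s) - o t) with hΦdef
  have hXΦ : ∀ s t v, X s t (S s v + o s) = S t (Φ s t v) + o t := fun s t v => by
    simp only [hΦdef, hSinv, sub_add_cancel]
  have hΦ : IsSemiflow G T Φ := by
    have hc : ∀ s ∈ Icc 0 T, ∀ v, ContinuousOn (fun t => Φ s t v) (Icc s T) := fun s hs v =>
      (hSc.comp continuous_neg).continuousOn.clm_apply
        ((hXcont s hs _).sub ho.continuousOn)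
    refine ⟨hc, fun s hs v r hr => ?_⟩
    have hr0 : r ∈ Icc 0 T := ⟨hs.1.trans hr.1, hr.2⟩
    have hint : ∫ u in s..r, S (r - u) (F (X s u (S s v + o s)))
        = S r (∫ u in s..r, G u (Φ s u v)) := by
      rw [← ContinuousLinearMap.intervalIntegral_comp_comm]
      · refine intervalIntegral.integral_congr fun u _ => ?_
        simp only [hGdef, ← hXΦ, hSadd, sub_eq_add_neg]
      · refine (hG.continuousOn_comp ((hc s hs v).mono ?_)).intervalIntegrable
        exact uIcc_subset_Icc ⟨le_rfl, hs.2⟩ hr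
    have h1 : Φ s r v = S (-r) (X s r (S s v + o s) - o r) := rfl
    rw [h1, hXeq s hs _ r hr, hint, hoO s hs, hoO r hr0, map_add (S (r - s)), hSadd,
      sub_add_cancel]
    have h2 : S r v + S (r - s) (O s) + S r (∫ u in s..r, G u (Φ s u v)) + O r
        - S (r - s) (O s) - O r = S r (v + ∫ u in s..r, G u (Φ s u v)) := by
      rw [map_add]; abel
    rw [h2, hSinv']
  obtain ⟨g, hg, hgm, hgb, hgl⟩ := exists_leftContinuous_step hT hθ0 hθsub hlfl0 hlfl
    (fun p => S (-p) (f (y p)))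
  have hgi : ∀ a b, IntervalIntegrable g volume a b := fun a b => by
    obtain ⟨M, hM⟩ := hgb
    exact (intervalIntegrable_const (c := M)).mono_fun hgm.aestronglyMeasurable
      (Filter.Eventually.of_forall fun s => (hM s).trans (le_abs_self M))
  set w : ℝ → H := fun s => S (-s) (y s - OO s) with hwdef
  have hwξ : ∀ s ∈ Icc 0 T, w s = ξ + ∫ r in (0 : ℝ)..s, g r := by
    intro s hs
    have hint : ∫ u in (0 : ℝ)..s, S (s - lfl u) (f (y (lfl u)))
        = S s (∫ u in (0 : ℝ)..s, g u) := by
      rw [← ContinuousLinearMap.intervalIntegral_comp_comm _ (hgi 0 s)]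
      refine intervalIntegral.integral_congr fun u hu => ?_
      rw [uIcc_of_le hs.1] at hu
      simp only [hg u ⟨hu.1, hu.2.trans hs.2⟩, hSadd, sub_eq_add_neg]
    simp only [hwdef]
    rw [hy s hs, hint, add_sub_cancel_right, ← map_add, hSinv']
  have hw0 : w 0 = ξ := by simpa using hwξ 0 ⟨le_rfl, hT.le⟩
  obtain ⟨hmeas, ⟨C, hC⟩, hint, heq⟩ := hΦ.alekseev_groebner hG hgm hgb hgl
    (w := w) (fun s hs => by rw [hw0, hwξ s hs]) ht
  have key : ∀ s ∈ Icc 0 t, (fderiv ℝ (fun z => X s t z) (y s - OO s + O s))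
      (S (s - lfl s) (f (y (lfl s))) - F (y s - OO s + O s))
      = S t (fderiv ℝ (Φ s t) (w s) (g s - G s (w s))) := by
    intro s hs
    have hsT : s ∈ Icc 0 T := ⟨hs.1, hs.2.trans ht.2⟩
    have hX : (fun z => X s t z) = fun z => S t (Φ s t (S (-s) (z - o s))) + o t := by
      funext z
      rw [← hXΦ, hSinv, sub_add_cancel]
    have hpt : S (-s) (y s - OO s + O s - o s) = w s := by
      rw [hoO s hsT, add_sub_cancel_right]
    have hd : HasFDerivAt (Φ s t) (fderiv ℝ (Φ s t) (w s))
        (S (-s) (y s - OO s + O s - o s)) := by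
      rw [hpt]
      exact (hΦ.differentiable hG hsT ⟨hs.2, ht.2⟩ (w s)).hasFDerivAt
    have hin : HasFDerivAt (fun z => S (-s) (z - o s)) (S (-s)) (y s - OO s + O s) := by
      simp only [map_sub]
      exact (S (-s)).hasFDerivAt.sub_const _
    have hd' : HasFDerivAt (fun z => S t (Φ s t (S (-s) (z - o s))) + o t)
        ((S t).comp ((fderiv ℝ (Φ s t) (w s)).comp (S (-s)))) (y s - OO s + O s) := by
      have hc := HasFDerivAt.comp (y s - OO s + O s) (g := Φ s t)
        (f := fun z => S (-s) (z - o s)) hd hin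
      exact ((S t).hasFDerivAt.comp (y s - OO s + O s) hc).add_const (o t)
    rw [hX, hd'.fderiv]
    simp only [ContinuousLinearMap.comp_apply, map_sub (S (-s))]
    rw [hg s hsT, hSadd, sub_eq_add_neg s, neg_add_cancel_left]
    simp only [hGdef, hwdef, hSinv, hoO s hsT]
  refine ⟨?_, ?_, ?_⟩
  · convert (S t).continuous.measurable.comp hmeas using 1
    funext s
    exact key s s.2
  · refine lt_of_le_of_lt (setLIntegral_mono' (g := fun _ => ENNReal.ofReal (‖S t‖ * C))
      measurableSet_Icc fun s hs => ?_) ?_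
    · rw [key s hs, ← enorm_eq_nnnorm, ← ofReal_norm]
      exact ENNReal.ofReal_le_ofReal (((S t).le_opNorm _).trans
        (mul_le_mul_of_nonneg_left (hC s hs) (norm_nonneg _)))
    · simp [ENNReal.mul_lt_top_iff]
  · have hcongr : ∫ s in (0 : ℝ)..t, (fderiv ℝ (fun z => X s t z) (y s - OO s + O s))
        (S (s - lfl s) (f (y (lfl s))) - F (y s - OO s + O s))
        = S t (∫ s in (0 : ℝ)..t, fderiv ℝ (Φ s t) (w s) (g s - G s (w s))) := by
      rw [← ContinuousLinearMap.intervalIntegral_comp_comm _ hint]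
      refine intervalIntegral.integral_congr fun s hs => ?_
      rw [uIcc_of_le ht.1] at hs
      exact key s hs
    have h0 : X 0 t (ξ + O 0) = S t (Φ 0 t (w 0)) + O t := by
      rw [← hoO t ht, ← hXΦ, hS0, hw0, hoO 0 ⟨le_rfl, hT.le⟩]
    have h1 : S t (w t) = y t - OO t := hSinv t _
    rw [hcongr, heq, map_sub, h1, h0]
    abel
end

section
/- For all t ∈ [0,T] it holds that ‖ e^{(t−⌊t⌋_θ)A} 𝕗(𝕪_{⌊t⌋_θ}) − F(𝕪_t − 𝕆_t + O_t) ‖_H ≤ |θ|_T^{γ−δ} ‖𝕗(𝕪_{⌊t⌋_θ})‖_{H_{γ−δ}} + ‖𝕗(𝕪_{⌊t⌋_θ}) − F(𝕪_{⌊t⌋_θ})‖_H + C ( |θ|_T^{γ−δ} ‖ξ‖_{H_γ} + |θ|_T^{1−δ} ‖𝕗(𝕪_{⌊t⌋_θ})‖_H + |θ|_T^{ι} ∫_0^{⌊t⌋_θ} (⌊t⌋_θ − ⌊s⌋_θ)^{−δ−ι} ‖𝕗(𝕪_{⌊s⌋_θ})‖_H ds + ‖𝕆_t − 𝕆_{⌊t⌋_θ}‖_{H_δ}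 + ‖𝕆_t − O_t‖_{H_δ} ) · ( 1 + ‖𝕪_{⌊t⌋_θ}‖_{H_κ}^c + ( ‖𝕪_t‖_{H_κ} + ‖𝕆_t − O_t‖_{H_κ} )^c ). -/
open MeasureTheory Set
open scoped ENNReal RealInnerProductSpace NNReal

/-- The operator acting on the `i`-th vector of the orthonormal basis `b` as multiplication
by `g i`. -/
noncomputable def OrthonormalBasis.diagonal {H : Type*} [NormedAddCommGroup H]
    [InnerProductSpace ℝ H] {ι : Type*} [Fintype ι] (b : OrthonormalBasis ι ℝ H) (g : ι → ℝ) :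
    H →L[ℝ] H :=
  ∑ i, g i • (innerSL ℝ (b i)).smulRight (b i)

namespace OrthonormalBasis

variable {H : Type*} [NormedAddCommGroup H] [InnerProductSpace ℝ H] {ι : Type*} [Fintype ι]
  (b : OrthonormalBasis ι ℝ H)

lemma diagonal_apply (g : ι → ℝ) (v : H) :
    b.diagonal g v = ∑ i, (g i * ⟪b i, v⟫) • b i := by
  simp [diagonal, smul_smul]

lemma inner_diagonal (g : ι → ℝ) (v : H) (i : ι) :
    ⟪b i, b.diagonal g v⟫ = g i * ⟪b i, v⟫ := by
  rw [diagonal_apply, b.orthonormal.inner_right_fintype]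

lemma diagonal_diagonal (g k : ι → ℝ) (v : H) :
    b.diagonal g (b.diagonal k v) = b.diagonal (fun i => g i * k i) v := by
  rw [b.diagonal_apply g, b.diagonal_apply (fun i => g i * k i)]
  simp only [inner_diagonal, mul_assoc]

lemma diagonal_one (v : H) : b.diagonal (fun _ => 1) v = v := by
  simp [diagonal_apply, b.sum_repr']

lemma diagonal_sub (g k : ι → ℝ) (v : H) :
    b.diagonal g v - b.diagonal k v = b.diagonal (fun i => g i - k i) v := by
  simp only [diagonal_apply, sub_mul, sub_smul, Finset.sum_sub_distrib]

lemma norm_diagonal_le {g k : ι → ℝ} (h : ∀ i, |g i| ≤ |k i|) (v : H) :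
    ‖b.diagonal g v‖ ≤ ‖b.diagonal k v‖ := by
  refine le_of_sq_le_sq ?_ (norm_nonneg _)
  rw [← b.sum_sq_norm_inner_right, ← b.sum_sq_norm_inner_right]
  refine Finset.sum_le_sum fun i _ => ?_
  rw [inner_diagonal, inner_diagonal, norm_mul, norm_mul]
  gcongr
  exact h i

lemma norm_diagonal_le_mul_diagonal {g k : ι → ℝ} {M : ℝ} (hM : 0 ≤ M)
    (h : ∀ i, |g i| ≤ M * |k i|) (v : H) :
    ‖b.diagonal g v‖ ≤ M * ‖b.diagonal k v‖ := by
  have hk : b.diagonal (fun i => M * k i) v = M • b.diagonal k v := by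
    simp only [diagonal_apply, Finset.smul_sum, smul_smul, mul_assoc]
  rw [← abs_of_nonneg hM, ← Real.norm_eq_abs, ← norm_smul, ← hk]
  exact b.norm_diagonal_le (fun i => by rw [abs_mul, abs_of_nonneg hM]; exact h i) v

lemma norm_diagonal_le_mul {g : ι → ℝ} {M : ℝ} (hM : 0 ≤ M) (h : ∀ i, |g i| ≤ M) (v : H) :
    ‖b.diagonal g v‖ ≤ M * ‖v‖ := by
  simpa only [diagonal_one] using
    b.norm_diagonal_le_mul_diagonal (k := fun _ => 1) hM (by simpa using h) v

end OrthonormalBasis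

lemma Real.rpow_le_exp {x a : ℝ} (hx : 0 ≤ x) (ha0 : 0 ≤ a) (ha1 : a ≤ 1) :
    x ^ a ≤ Real.exp x := by
  rcases le_total x 1 with h | h
  · exact (Real.rpow_le_one hx h ha0).trans (Real.one_le_exp hx)
  · calc x ^ a ≤ x ^ (1 : ℝ) := Real.rpow_le_rpow_of_exponent_le h ha1
      _ = x := Real.rpow_one x
      _ ≤ Real.exp x := by linarith [Real.add_one_le_exp x]

lemma Real.abs_exp_neg_sub_one_le_rpow {x a : ℝ} (hx : 0 ≤ x) (ha0 : 0 ≤ a) (ha1 : a ≤ 1) :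
    |Real.exp (-x) - 1| ≤ x ^ a := by
  rw [abs_sub_comm, abs_of_nonneg (by simpa using hx)]
  rcases le_total x 1 with h | h
  · rcases hx.eq_or_lt with rfl | hx'
    · simpa using Real.zero_rpow_nonneg a
    · calc 1 - Real.exp (-x) ≤ x ^ (1 : ℝ) := by
            rw [Real.rpow_one]; linarith [Real.add_one_le_exp (-x)]
        _ ≤ x ^ a := Real.rpow_le_rpow_of_exponent_ge hx' h ha1
  · linarith [Real.exp_pos (-x), Real.one_le_rpow h ha0]

/-- Smoothing estimate `‖(-A)^a e^{sA}‖ ≤ s^{-a}` on a single eigenvalue. -/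
lemma Real.rpow_mul_exp_neg_le {l s a : ℝ} (hl : 0 ≤ l) (hs : 0 < s) (ha0 : 0 ≤ a)
    (ha1 : a ≤ 1) : l ^ a * Real.exp (-(s * l)) ≤ s ^ (-a) := by
  rw [Real.rpow_neg hs.le, Real.exp_neg, ← div_eq_mul_inv, ← one_div,
    div_le_div_iff₀ (Real.exp_pos _) (Real.rpow_pos_of_pos hs a), one_mul, mul_comm,
    ← Real.mul_rpow hs.le hl]
  exact Real.rpow_le_exp (by positivity) ha0 ha1

lemma Real.abs_exp_mul_sub_one_le {l h m a : ℝ} (hl : l ≤ 0) (hh : 0 ≤ h) (hm : h ≤ m)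
    (ha0 : 0 ≤ a) (ha1 : a ≤ 1) : |Real.exp (h * l) - 1| ≤ m ^ a * (-l) ^ a := by
  rw [← Real.mul_rpow (hh.trans hm) (by linarith)]
  calc |Real.exp (h * l) - 1| = |Real.exp (-(h * -l)) - 1| := by simp
    _ ≤ (h * -l) ^ a :=
      Real.abs_exp_neg_sub_one_le_rpow (mul_nonneg hh (by linarith)) ha0 ha1
    _ ≤ (m * -l) ^ a := by
      have : 0 ≤ -l := by linarith
      gcongr

section LastGridPoint

variable {θ : Finset ℝ} {lfl : ℝ → ℝ}

lemma monotoneOn_lastGridPoint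
    (hlfl : ∀ t : ℝ, 0 < t → IsGreatest {x : ℝ | x ∈ θ ∧ x < t} (lfl t)) :
    MonotoneOn lfl (Ioi 0) := fun s hs t ht hst =>
  (hlfl t ht).2 ⟨(hlfl s hs).1.1, (hlfl s hs).1.2.trans_le hst⟩

lemma intervalIntegrable_comp_lastGridPoint {G : Type*} [NormedAddCommGroup G]
    (hlfl : ∀ t : ℝ, 0 < t → IsGreatest {x : ℝ | x ∈ θ ∧ x < t} (lfl t)) (g : ℝ → G)
    {p q : ℝ} (hp : 0 ≤ p) (hpq : p ≤ q) :
    IntervalIntegrable (fun u => g (lfl u)) volume p q := by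
  rw [intervalIntegrable_iff_integrableOn_Ioc_of_le hpq]
  have hmeas : ∀ a, MeasurableSet (Ioi 0 ∩ lfl ⁻¹' {a}) := fun a => by
    refine Set.OrdConnected.measurableSet ⟨fun s hs t ht u hu => ?_⟩
    have hu0 : u ∈ Ioi (0 : ℝ) := lt_of_lt_of_le hs.1 hu.1
    have hmono := monotoneOn_lastGridPoint hlfl
    exact ⟨hu0, le_antisymm ((hmono hu0 ht.1 hu.2).trans_eq ht.2)
      (hs.2.symm.trans_le (hmono hs.1 hu0 hu.1))⟩
  have hsum : IntegrableOn
      (fun u => ∑ a ∈ θ, (Ioi 0 ∩ lfl ⁻¹' {a}).indicator (fun _ => g a) u) (Ioc p q) :=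
    integrable_finsetSum _ fun a _ =>
      (integrableOn_const (by simp)).indicator (hmeas a)
  refine hsum.congr_fun (fun u hu => ?_) measurableSet_Ioc
  have hu0 : 0 < u := hp.trans_lt hu.1
  simp only
  rw [Finset.sum_eq_single (lfl u)]
  · exact indicator_of_mem (show u ∈ Ioi 0 ∩ lfl ⁻¹' {lfl u} from ⟨hu0, rfl⟩) _
  · exact fun a _ ha => indicator_of_notMem (fun h => ha h.2.symm) _
  · exact fun h => absurd (hlfl u hu0).1.1 h

lemma lastGridPoint_eq
    (hlfl : ∀ t : ℝ, 0 < t → IsGreatest {x : ℝ | x ∈ θ ∧ x < t} (lfl t)) {t u : ℝ}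
    (ht : 0 < t) (hu0 : 0 < u) (hu : u ∈ Ioc (lfl t) t) : lfl u = lfl t :=
  le_antisymm (monotoneOn_lastGridPoint hlfl hu0 ht hu.2)
    ((hlfl u hu0).2 ⟨(hlfl t ht).1.1, hu.1⟩)

lemma sub_lastGridPoint_le_mesh
    (hlfl : ∀ t : ℝ, 0 < t → IsGreatest {x : ℝ | x ∈ θ ∧ x < t} (lfl t)) {mesh T t : ℝ}
    (hθT : T ∈ θ)
    (hmesh : IsGreatest
      {x : ℝ | 0 < x ∧ ∃ a ∈ θ, ∃ e ∈ θ, x = e - a ∧ ∀ z ∈ θ, ¬(a < z ∧ z < e)} mesh)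
    (ht0 : 0 < t) (htT : t ≤ T) : t - lfl t ≤ mesh := by
  have hne : (θ.filter (t ≤ ·)).Nonempty := ⟨T, by simp [hθT, htT]⟩
  obtain ⟨e, he, hmin⟩ := Finset.exists_min_image _ id hne
  simp only [Finset.mem_filter, id] at he hmin
  have hlt := (hlfl t ht0).1.2
  have : e - lfl t ≤ mesh := hmesh.2 ⟨by linarith, lfl t, (hlfl t ht0).1.1, e, he.1, rfl,
    fun z hz hze => by
      rcases lt_or_ge z t with h | h
      · exact hze.1.not_ge ((hlfl t ht0).2 ⟨hz, h⟩)
      · exact hze.2.not_ge (hmin z ⟨hz, h⟩)⟩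
  linarith

end LastGridPoint

/-- In the setting of Statement 1, with fractional powers
`Ap r = (−A)^r` (so `‖v‖_{H_r} = ‖Ap r v‖`), mesh `|θ|_T = mesh`, constants
`C, c ∈ [1,∞)`, `γ ∈ [0,1]`, `δ ∈ [0,γ]`, `iota ∈ [0,1−δ]`, `κ ∈ ℝ`, and `F`
satisfying `‖F x − F z‖ ≤ C ‖x−z‖_{H_δ} (1 + ‖x‖_{H_κ}^c + ‖z‖_{H_κ}^c)`:
for all `t ∈ [0,T]`, the one-step error
`‖e^{(t−⌊t⌋_θ)A} 𝕗(𝕪_{⌊t⌋_θ}) − F(𝕪_t − 𝕆_t + O_t)‖` is bounded by the stated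
expression. -/
theorem stmt_3
    {H : Type*} [NormedAddCommGroup H] [InnerProductSpace ℝ H]
    [FiniteDimensional ℝ H] [Nontrivial H] [MeasurableSpace H] [BorelSpace H]
    {ι : Type*} [Fintype ι] (b : OrthonormalBasis ι ℝ H)
    (lam : ι → ℝ) (hlam : ∀ i, lam i < 0)
    (E : ℝ → H → H)
    (hE : ∀ t v, E t v = ∑ i, (Real.exp (t * lam i) * ⟪b i, v⟫) • b i)
    (Ap : ℝ → H → H)
    (hAp : ∀ r v, Ap r v = ∑ i, (((-lam i) ^ r) * ⟪b i, v⟫) • b i)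
    (T : ℝ) (hT : 0 < T)
    (θ : Finset ℝ) (hθ0 : (0 : ℝ) ∈ θ) (hθT : T ∈ θ)
    (hθsub : ∀ x ∈ θ, x ∈ Set.Icc (0 : ℝ) T)
    (mesh : ℝ)
    (hmesh : IsGreatest
      {x : ℝ | 0 < x ∧ ∃ a ∈ θ, ∃ e ∈ θ, x = e - a ∧ ∀ z ∈ θ, ¬(a < z ∧ z < e)} mesh)
    (lfl : ℝ → ℝ) (hlfl0 : lfl 0 = 0)
    (hlfl : ∀ t : ℝ, 0 < t → IsGreatest {x : ℝ | x ∈ θ ∧ x < t} (lfl t))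
    (ξ : H)
    (O : ℝ → H) (hO : ContinuousOn O (Set.Icc (0 : ℝ) T))
    (OO : ℝ → H) (hOO : Measurable fun t : Set.Icc (0 : ℝ) T => OO ↑t)
    (F : H → H) (hF : ContDiff ℝ 1 F)
    (f : H → H)
    (X : ℝ → ℝ → H → H)
    (hXcont : ∀ s ∈ Set.Icc (0 : ℝ) T, ∀ x : H,
      ContinuousOn (fun t => X s t x) (Set.Icc s T))
    (hXeq : ∀ s ∈ Set.Icc (0 : ℝ) T, ∀ x : H, ∀ t ∈ Set.Icc s T,
      X s t x = E (t - s) x + (∫ u in s..t, E (t - u) (F (X s u x))) + O t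
        - E (t - s) (O s))
    (y : ℝ → H)
    (hy : ∀ t ∈ Set.Icc (0 : ℝ) T,
      y t = E t ξ + (∫ u in (0 : ℝ)..t, E (t - lfl u) (f (y (lfl u)))) + OO t)
    (C c γ δ iota κ : ℝ)
    (hC : 1 ≤ C) (hc : 1 ≤ c)
    (hγ : γ ∈ Set.Icc (0 : ℝ) 1) (hδ : δ ∈ Set.Icc 0 γ)
    (hiota : iota ∈ Set.Icc 0 (1 - δ))
    (hFlip : ∀ x z : H,
      ‖F x - F z‖ ≤ C * ‖Ap δ (x - z)‖ * (1 + ‖Ap κ x‖ ^ c + ‖Ap κ z‖ ^ c)) :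
    ∀ t ∈ Set.Icc (0 : ℝ) T,
      ‖E (t - lfl t) (f (y (lfl t))) - F (y t - OO t + O t)‖ ≤
        mesh ^ (γ - δ) * ‖Ap (γ - δ) (f (y (lfl t)))‖ +
        ‖f (y (lfl t)) - F (y (lfl t))‖ +
        C * (mesh ^ (γ - δ) * ‖Ap γ ξ‖ +
             mesh ^ (1 - δ) * ‖f (y (lfl t))‖ +
             mesh ^ iota *
               (∫ s in (0 : ℝ)..(lfl t), (lfl t - lfl s) ^ (-δ - iota) * ‖f (y (lfl s))‖) +
             ‖Ap δ (OO t - OO (lfl t))‖ + ‖Ap δ (OO t - O t)‖) *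
          (1 + ‖Ap κ (y (lfl t))‖ ^ c + (‖Ap κ (y t)‖ + ‖Ap κ (OO t - O t)‖) ^ c) := by
  intro t ht
  obtain ⟨hδ0, hδγ⟩ := hδ
  obtain ⟨hi0, hi1⟩ := hiota
  have hγ1 := hγ.2
  have hE' : ∀ s v, E s v = b.diagonal (fun i => Real.exp (s * lam i)) v := fun s v => by
    rw [hE, b.diagonal_apply]
  have hAp' : ∀ r v, Ap r v = b.diagonal (fun i => (-lam i) ^ r) v := fun r v => by
    rw [hAp, b.diagonal_apply]
  have hl0 : ∀ i, 0 < -lam i := fun i => neg_pos.2 (hlam i)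
  have hm0 : 0 < mesh := hmesh.1.1
  have hgrid : 0 ≤ lfl t ∧ lfl t ≤ t ∧ t - lfl t ≤ mesh := by
    rcases ht.1.eq_or_lt with rfl | h
    · simp [hlfl0, hm0.le]
    · exact ⟨(hlfl t h).2 ⟨hθ0, h⟩, (hlfl t h).1.2.le,
        sub_lastGridPoint_le_mesh hlfl hθT hmesh h ht.2⟩
  obtain ⟨hr0, hrt, hrm⟩ := hgrid
  set r := lfl t with hr
  set h := t - r with hh
  have hh0 : 0 ≤ h := sub_nonneg.2 hrt
  have hexp : ∀ i s, Real.exp ((h + s) * lam i) - Real.exp (s * lam i)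
      = (Real.exp (h * lam i) - 1) * Real.exp (s * lam i) := fun i s => by
    rw [add_mul, Real.exp_add]; ring
  have hexp1 : ∀ i s, 0 ≤ s → Real.exp (s * lam i) ≤ 1 := fun i s hs =>
    Real.exp_le_one_iff.2 (mul_nonpos_of_nonneg_of_nonpos hs (hlam i).le)
  have hnorm_sub : ‖E h (f (y r)) - f (y r)‖ ≤ mesh ^ (γ - δ) * ‖Ap (γ - δ) (f (y r))‖ := by
    have : E h (f (y r)) - f (y r)
        = b.diagonal (fun i => Real.exp (h * lam i) - 1) (f (y r)) := by
      rw [hE', ← b.diagonal_sub, b.diagonal_one]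
    rw [this, hAp']
    refine b.norm_diagonal_le_mul_diagonal (by positivity) (fun i => ?_) _
    rw [abs_of_pos (Real.rpow_pos_of_pos (hl0 i) _)]
    exact Real.abs_exp_mul_sub_one_le (hlam i).le hh0 hrm (by linarith) (by linarith)
  have hinit : ‖Ap δ (E t ξ - E r ξ)‖ ≤ mesh ^ (γ - δ) * ‖Ap γ ξ‖ := by
    rw [hE', hE', b.diagonal_sub, hAp', hAp', b.diagonal_diagonal]
    refine b.norm_diagonal_le_mul_diagonal (by positivity) (fun i => ?_) _
    rw [show t = h + r by rw [hh]; ring, hexp, abs_mul, abs_mul, Real.abs_exp,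
      abs_of_pos (Real.rpow_pos_of_pos (hl0 i) _), abs_of_pos (Real.rpow_pos_of_pos (hl0 i) _)]
    have h1 := Real.abs_exp_mul_sub_one_le (a := γ - δ) (hlam i).le hh0 hrm
      (by linarith) (by linarith)
    have hp := Real.rpow_pos_of_pos (hl0 i) δ
    calc (-lam i) ^ δ * (|Real.exp (h * lam i) - 1| * Real.exp (r * lam i))
        ≤ (-lam i) ^ δ * ((mesh ^ (γ - δ) * (-lam i) ^ (γ - δ)) * 1) := by
          gcongr
          · have := Real.rpow_pos_of_pos (hl0 i) (γ - δ)
            positivity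
          · exact hexp1 i r hr0
      _ = mesh ^ (γ - δ) * ((-lam i) ^ δ * (-lam i) ^ (γ - δ)) := by ring
      _ = mesh ^ (γ - δ) * (-lam i) ^ γ := by
          rw [← Real.rpow_add (hl0 i), add_sub_cancel]
  have hlast : ‖Ap δ (∫ u in r..t, E (t - lfl u) (f (y (lfl u))))‖
      ≤ mesh ^ (1 - δ) * ‖f (y r)‖ := by
    rcases hrt.eq_or_lt with heq | hlt
    · rw [← heq, intervalIntegral.integral_same, hAp', map_zero, norm_zero]
      positivity
    have hconst : ∫ u in r..t, E (t - lfl u) (f (y (lfl u))) = h • E h (f (y r)) := by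
      rw [← intervalIntegral.integral_const]
      refine intervalIntegral.integral_congr_ae (Filter.Eventually.of_forall fun u hu => ?_)
      rw [uIoc_of_le hrt] at hu
      rw [lastGridPoint_eq hlfl (hr0.trans_lt hlt) (hr0.trans_lt hu.1) hu]
    have hhpos : 0 < h := sub_pos.2 hlt
    rw [hconst, hAp', map_smul, norm_smul, hE', b.diagonal_diagonal, Real.norm_of_nonneg hh0]
    calc h * ‖b.diagonal (fun i => (-lam i) ^ δ * Real.exp (h * lam i)) (f (y r))‖
        ≤ h * (h ^ (-δ) * ‖f (y r)‖) := by
          gcongr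
          refine b.norm_diagonal_le_mul (by positivity) (fun i => ?_) _
          rw [abs_of_pos (mul_pos (Real.rpow_pos_of_pos (hl0 i) _) (Real.exp_pos _))]
          simpa using Real.rpow_mul_exp_neg_le (hl0 i).le hhpos hδ0 (by linarith)
      _ = h ^ (1 - δ) * ‖f (y r)‖ := by
          rw [← mul_assoc, sub_eq_add_neg, Real.rpow_add hhpos, Real.rpow_one]
      _ ≤ mesh ^ (1 - δ) * ‖f (y r)‖ := by
          gcongr
          linarith
  have hhist : ‖Ap δ (∫ u in (0 : ℝ)..r,
        (E (t - lfl u) (f (y (lfl u))) - E (r - lfl u) (f (y (lfl u)))))‖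
      ≤ mesh ^ iota * ∫ s in (0 : ℝ)..r, (r - lfl s) ^ (-δ - iota) * ‖f (y (lfl s))‖ := by
    rw [hAp', ← ContinuousLinearMap.intervalIntegral_comp_comm _
      (intervalIntegrable_comp_lastGridPoint hlfl
        (fun v => E (t - v) (f (y v)) - E (r - v) (f (y v))) le_rfl hr0),
      ← intervalIntegral.integral_const_mul]
    refine intervalIntegral.norm_integral_le_of_norm_le hr0
      (Filter.Eventually.of_forall fun u hu => ?_)
      (intervalIntegrable_comp_lastGridPoint hlfl
        (fun v => mesh ^ iota * ((r - v) ^ (-δ - iota) * ‖f (y v)‖)) le_rfl hr0)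
    have hs : 0 < r - lfl u := sub_pos.2 ((hlfl u hu.1).1.2.trans_le hu.2)
    set s := r - lfl u with hsdef
    rw [show t - lfl u = h + s by rw [hh, hsdef]; ring, hE', hE', b.diagonal_sub,
      b.diagonal_diagonal, ← mul_assoc]
    refine b.norm_diagonal_le_mul (by positivity) (fun i => ?_) _
    rw [hexp, abs_mul, abs_mul, Real.abs_exp, abs_of_pos (Real.rpow_pos_of_pos (hl0 i) _)]
    have h1 := Real.abs_exp_mul_sub_one_le (a := iota) (hlam i).le hh0 hrm hi0 (by linarith)
    have h2 := Real.rpow_mul_exp_neg_le (a := δ + iota) (hl0 i).le hs (by linarith)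
      (by linarith)
    rw [mul_neg, neg_neg, neg_add, ← sub_eq_add_neg] at h2
    have hp := Real.rpow_pos_of_pos (hl0 i) δ
    calc (-lam i) ^ δ * (|Real.exp (h * lam i) - 1| * Real.exp (s * lam i))
        ≤ (-lam i) ^ δ * ((mesh ^ iota * (-lam i) ^ iota) * Real.exp (s * lam i)) := by
          gcongr
      _ = mesh ^ iota * ((-lam i) ^ (δ + iota) * Real.exp (s * lam i)) := by
          rw [Real.rpow_add (hl0 i)]; ring
      _ ≤ mesh ^ iota * s ^ (-δ - iota) := by gcongr
  have hdecomp : y r - (y t - OO t + O t) = -((E t ξ - E r ξ)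
      + (∫ u in r..t, E (t - lfl u) (f (y (lfl u))))
      + (∫ u in (0 : ℝ)..r, (E (t - lfl u) (f (y (lfl u))) - E (r - lfl u) (f (y (lfl u)))))
      + (OO t - OO r)) + (OO t - O t) := by
    have hint : ∀ q {p₁ p₂ : ℝ}, 0 ≤ p₁ → p₁ ≤ p₂ →
        IntervalIntegrable (fun u => E (q - lfl u) (f (y (lfl u)))) volume p₁ p₂ :=
      fun q _ _ => intervalIntegrable_comp_lastGridPoint hlfl (fun v => E (q - v) (f (y v)))
    rw [hy t ht, hy r ⟨hr0, hrt.trans ht.2⟩,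
      intervalIntegral.integral_sub (hint t le_rfl hr0) (hint r le_rfl hr0),
      ← intervalIntegral.integral_add_adjacent_intervals (hint t le_rfl hr0) (hint t hr0 hrt)]
    abel
  have hδbound : ‖Ap δ (y r - (y t - OO t + O t))‖ ≤
      mesh ^ (γ - δ) * ‖Ap γ ξ‖ + mesh ^ (1 - δ) * ‖f (y r)‖ +
        mesh ^ iota * (∫ s in (0 : ℝ)..r, (r - lfl s) ^ (-δ - iota) * ‖f (y (lfl s))‖) +
        ‖Ap δ (OO t - OO r)‖ + ‖Ap δ (OO t - O t)‖ := by
    have hadd : ∀ v w, Ap δ (v + w) = Ap δ v + Ap δ w := fun v w => by simp only [hAp', map_add]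
    have hneg : ∀ v, Ap δ (-v) = -Ap δ v := fun v => by simp only [hAp', map_neg]
    rw [hdecomp, hadd, hneg, hadd, hadd, hadd]
    refine (norm_add_le _ _).trans (add_le_add_left ?_ _)
    rw [norm_neg]
    exact (norm_add_le _ _).trans (add_le_add_left ((norm_add₃_le).trans
      (add_le_add (add_le_add hinit hlast) hhist)) _)
  have hκbound : ‖Ap κ (y t - OO t + O t)‖ ≤ ‖Ap κ (y t)‖ + ‖Ap κ (OO t - O t)‖ := by
    rw [show y t - OO t + O t = y t - (OO t - O t) by abel, hAp', map_sub, ← hAp', ← hAp']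
    exact norm_sub_le _ _
  have hFbound : ‖F (y r) - F (y t - OO t + O t)‖ ≤ _ :=
    (hFlip (y r) (y t - OO t + O t)).trans (mul_le_mul
      (mul_le_mul_of_nonneg_left hδbound (by linarith))
      (add_le_add_right (Real.rpow_le_rpow (norm_nonneg _) hκbound (by linarith)) _)
      (by positivity)
      (mul_nonneg (by linarith) ((norm_nonneg _).trans hδbound)))
  calc ‖E h (f (y r)) - F (y t - OO t + O t)‖
      = ‖(E h (f (y r)) - f (y r)) + (f (y r) - F (y r))
          + (F (y r) - F (y t - OO t + O t))‖ := by congr 1; abel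
    _ ≤ _ := norm_add₃_le.trans (add_le_add (add_le_add hnorm_sub le_rfl) hFbound)
end

section
/- With Δ_T = {(u,v) ∈ [0,T]² : u ≤ v}: (i) for every ω ∈ Ω the map Δ_T × H ∋ (s,t,x) ↦ X_{s,t}^x(ω) ∈ H is of class C^{0,0,1} (jointly continuous, Fréchet differentiable in x for each fixed (s,t), and with jointly continuous derivative (s,t,x) ↦ ∂_x X_{s,t}^x(ω) ∈ L(H)); (ii) the map Δ_T × Ω ∋ (s,t,ω) ↦ X_{s,t}^{Y_s(ω)}(ω) ∈ H is (ℬ(Δ_T) ⊗ 𝔉)/ℬ(H)-measurable; and (iii) the map Δ_T × Ω ∋ (s,t,ω) ↦ ∂_x X_{s,t}^{Z_s(ω)}(ω) ∈ L(H) is (ℬ(Δ_T) ⊗ 𝔉)/ℬ(L(H))-measurable. -/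
open MeasureTheory Set
open scoped ENNReal RealInnerProductSpace NNReal

/-- Global existence on `[0, 1]` for linear ordinary differential equations. -/
theorem exists_linear_ode_solution {E : Type*} [NormedAddCommGroup E] [NormedSpace ℝ E]
    [CompleteSpace E] (B : ℝ → E →L[ℝ] E) (hB : Continuous B) (x₀ : E) :
    ∃ α : ℝ → E, α 0 = x₀ ∧
      ∀ t ∈ Icc (0 : ℝ) 1, HasDerivWithinAt α (B t (α t)) (Icc 0 1) t := by
  obtain ⟨M', hM'⟩ := (isCompact_Icc (a := (0 : ℝ)) (b := 1)).exists_bound_of_continuousOn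
    hB.continuousOn
  obtain ⟨M, hM0, hM⟩ : ∃ M : ℝ, 0 ≤ M ∧ ∀ t ∈ Icc (0 : ℝ) 1, ‖B t‖ ≤ M :=
    ⟨max M' 0, le_max_right _ _, fun t ht => (hM' t ht).trans (le_max_left _ _)⟩
  obtain ⟨R, hR0, hR⟩ : ∃ R : ℝ, 0 < R ∧ ‖x₀‖ * Real.exp M ≤ R :=
    ⟨‖x₀‖ * Real.exp M + 1, by positivity, by linarith⟩
  set θ : E → ℝ := fun x => max 0 (min 1 (2 - ‖x‖ / R)) with hθ
  have hθ0 : ∀ x, 0 ≤ θ x := fun x => le_max_left _ _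
  have hθ1 : ∀ x, θ x ≤ 1 := fun x => max_le zero_le_one (min_le_left _ _)
  have hθR : ∀ x, ‖x‖ ≤ R → θ x = 1 := fun x hx => by
    have : ‖x‖ / R ≤ 1 := (div_le_one hR0).2 hx
    simp only [hθ]
    rw [min_eq_left (by linarith), max_eq_right zero_le_one]
  have hθ2 : ∀ x, θ x * ‖x‖ ≤ 2 * R := fun x => by
    rcases le_or_gt ‖x‖ (2 * R) with h | h
    · nlinarith [hθ0 x, hθ1 x, norm_nonneg x]
    · have : 2 ≤ ‖x‖ / R := (le_div_iff₀ hR0).2 h.le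
      have h0 : θ x = 0 := by
        simp only [hθ]
        exact max_eq_left ((min_le_right _ _).trans (by linarith))
      rw [h0, zero_mul]; positivity
  have clamp : ∀ a b : ℝ, |max 0 (min 1 a) - max 0 (min 1 b)| ≤ |a - b| := fun a b => by
    simpa [Real.dist_eq] using ((LipschitzWith.id.const_min (1 : ℝ)).const_max 0).dist_le_mul a b
  have hθL : ∀ x y, |θ x - θ y| ≤ ‖x - y‖ / R := fun x y => by
    calc |θ x - θ y| ≤ |(2 - ‖x‖ / R) - (2 - ‖y‖ / R)| := by
          simp only [hθ]; exact clamp _ _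
      _ = |‖x‖ - ‖y‖| / R := by
          rw [← abs_of_pos hR0, ← abs_div, abs_of_pos hR0, ← abs_neg]; congr 1; ring
      _ ≤ ‖x - y‖ / R := by gcongr; exact abs_norm_sub_norm_le x y
  have hb : ∀ t ∈ Icc (0 : ℝ) 1, ∀ x, ‖B t x‖ ≤ M * ‖x‖ := fun t ht x =>
    (B t).le_of_opNorm_le (hM t ht) x
  have hPL : IsPicardLindelof (fun t x => θ x • B t x) (⟨0, by simp⟩ : Icc (0 : ℝ) 1) x₀
      ⟨M * (2 * R), by positivity⟩ 0 ⟨M * (2 * R), by positivity⟩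
      ⟨M + (‖x₀‖ + M * (2 * R)) * M / R, by positivity⟩ := by
    refine ⟨fun t ht => ?_, fun x _ => ?_, fun t ht x _ => ?_, ?_⟩
    · refine LipschitzOnWith.of_dist_le_mul fun x hx y hy => ?_
      have hy' : ‖y‖ ≤ ‖x₀‖ + M * (2 * R) := by
        have h1 : dist y x₀ ≤ M * (2 * R) := hy
        rw [dist_eq_norm] at h1
        calc ‖y‖ = ‖x₀ + (y - x₀)‖ := by congr 1; abel
          _ ≤ _ := (norm_add_le _ _).trans (by gcongr)
      rw [dist_eq_norm, dist_eq_norm]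
      calc ‖θ x • B t x - θ y • B t y‖
          = ‖θ x • B t (x - y) + (θ x - θ y) • B t y‖ := by
            congr 1; rw [map_sub, smul_sub, sub_smul]; abel
        _ ≤ θ x * ‖B t (x - y)‖ + |θ x - θ y| * ‖B t y‖ := by
            refine (norm_add_le _ _).trans_eq ?_
            rw [norm_smul, norm_smul, Real.norm_eq_abs, Real.norm_eq_abs, abs_of_nonneg (hθ0 x)]
        _ ≤ 1 * (M * ‖x - y‖) + ‖x - y‖ / R * (M * (‖x₀‖ + M * (2 * R))) := by
            gcongr
            · exact hθ1 x
            · exact hb t ht _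
            · exact hθL x y
            · exact (hb t ht y).trans (by gcongr)
        _ = (M + (‖x₀‖ + M * (2 * R)) * M / R) * ‖x - y‖ := by ring
    · fun_prop
    · rw [norm_smul, Real.norm_eq_abs, abs_of_nonneg (hθ0 x)]
      calc θ x * ‖B t x‖ ≤ θ x * (M * ‖x‖) := by
            exact mul_le_mul_of_nonneg_left (hb t ht x) (hθ0 x)
        _ = M * (θ x * ‖x‖) := by ring
        _ ≤ M * (2 * R) := mul_le_mul_of_nonneg_left (hθ2 x) hM0
    · simp
  obtain ⟨α, hα0, hα⟩ := hPL.exists_eq_forall_mem_Icc_hasDerivWithinAt₀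
  have hα0 : α 0 = x₀ := hα0
  have hbd : ∀ t ∈ Icc (0 : ℝ) 1, ‖α t‖ ≤ gronwallBound ‖x₀‖ M 0 (t - 0) := by
    refine norm_le_gronwallBound_of_norm_deriv_right_le (fun t ht => (hα t ht).continuousWithinAt)
      (fun t ht => (hα t ⟨ht.1, ht.2.le⟩).mono_of_mem_nhdsWithin (Icc_mem_nhdsGE_of_mem ht))
      (by rw [hα0]) fun t ht => ?_
    rw [norm_smul, Real.norm_eq_abs, abs_of_nonneg (hθ0 _), add_zero]
    calc θ (α t) * ‖B t (α t)‖ ≤ 1 * (M * ‖α t‖) := by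
          gcongr
          · exact hθ1 _
          · exact hb t ⟨ht.1, ht.2.le⟩ _
      _ = _ := one_mul _
  refine ⟨α, hα0, fun t ht => ?_⟩
  have h := hα t ht
  rwa [hθR, one_smul] at h
  refine (hbd t ht).trans (le_trans ?_ hR)
  rw [gronwallBound_ε0]
  gcongr
  nlinarith [ht.1, ht.2]

/-- Solutions on `[0, 1]` of a family of ordinary differential equations whose vector fields and
initial values depend continuously on a parameter depend jointly continuously on the parameter and
on time. -/
theorem continuous_ode_solution {P E : Type*} [TopologicalSpace P] [NormedAddCommGroup E]
    [NormedSpace ℝ E] [ProperSpace E] (g : P → ℝ → E → E) (g' : P → ℝ → E → E →L[ℝ] E)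
    (hg : Continuous fun q : P × ℝ × E => g q.1 q.2.1 q.2.2)
    (hg' : Continuous fun q : P × ℝ × E => g' q.1 q.2.1 q.2.2)
    (hgd : ∀ p t x, HasFDerivAt (g p t) (g' p t x) x) (y : P → ℝ → E)
    (hy : ∀ p, ∀ t ∈ Icc (0 : ℝ) 1, HasDerivWithinAt (y p) (g p t (y p t)) (Icc 0 1) t)
    (hy0 : Continuous fun p => y p 0) :
    Continuous fun q : P × Icc (0 : ℝ) 1 => y q.1 q.2 := by
  have hyc : ∀ p, ContinuousOn (y p) (Icc 0 1) := fun p t ht => (hy p t ht).continuousWithinAt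
  have key : ∀ p₀, ∀ ε > 0, ∀ᶠ p in nhds p₀, ∀ t ∈ Icc (0 : ℝ) 1, dist (y p t) (y p₀ t) < ε := by
    intro p₀ ε hε
    obtain ⟨R, hR⟩ := isCompact_Icc.exists_bound_of_continuousOn (hyc p₀)
    set K : Set (ℝ × E) := Icc 0 1 ×ˢ Metric.closedBall 0 (R + ε)
    have hK : IsCompact K := isCompact_Icc.prod (isCompact_closedBall _ _)
    have hslice : Continuous fun q : ℝ × E => g' p₀ q.1 q.2 :=
      hg'.comp (by fun_prop : Continuous fun q : ℝ × E => (p₀, q.1, q.2))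
    obtain ⟨M', hM'⟩ := hK.exists_bound_of_continuousOn hslice.continuousOn
    obtain ⟨M, hM⟩ : ∃ M : ℝ≥0, ∀ q ∈ K, ‖g' p₀ q.1 q.2‖ < M :=
      ⟨(M' + 1).toNNReal, fun q hq => by
        have := hM' q hq
        exact lt_of_lt_of_le (by linarith) (Real.le_coe_toNNReal _)⟩
    have hMp : ∀ᶠ p in nhds p₀, ∀ q ∈ K, ‖g' p q.1 q.2‖ < M :=
      hK.eventually_forall_of_forall_eventually fun q hq =>
        hg'.norm.continuousAt.eventually_lt (f := fun z : P × ℝ × E => ‖g' z.1 z.2.1 z.2.2‖)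
          (g := fun _ => (M : ℝ)) (x₀ := (p₀, q)) continuousAt_const (hM q hq)
    obtain ⟨δ, hδ, hδ0⟩ : ∃ δ : ℝ, gronwallBound δ M (0 + δ) 1 < ε ∧ 0 < δ := by
      have hc : Continuous fun δ : ℝ => gronwallBound δ M (0 + δ) 1 := by
        unfold gronwallBound
        split_ifs <;> fun_prop
      have h0 : gronwallBound 0 M (0 + 0) 1 < ε := by
        rwa [add_zero, gronwallBound_ε0_δ0]
      exact ((((hc.tendsto 0).eventually_lt_const h0).filter_mono nhdsWithin_le_nhds).and
        (self_mem_nhdsWithin (s := Ioi 0))).exists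
    have hgp : ∀ᶠ p in nhds p₀, ∀ q ∈ K, dist (g p₀ q.1 q.2) (g p q.1 q.2) < δ := by
      refine hK.eventually_forall_of_forall_eventually fun q _ => ?_
      have h : Continuous fun z : P × ℝ × E => dist (g p₀ z.2.1 z.2.2) (g z.1 z.2.1 z.2.2) :=
        (hg.comp (by fun_prop : Continuous fun z : P × ℝ × E => (p₀, z.2.1, z.2.2))).dist hg
      exact (h.tendsto (p₀, q)).eventually_lt_const (by simpa using hδ0)
    have hi : ∀ᶠ p in nhds p₀, dist (y p 0) (y p₀ 0) < δ :=
      ((hy0.dist continuous_const).tendsto p₀).eventually_lt_const (by simpa using hδ0)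
    filter_upwards [hMp, hgp, hi] with p hp1 hp2 hp3
    by_contra! hcon
    have hdc : ContinuousOn (fun t => dist (y p t) (y p₀ t)) (Icc 0 1) := 
      continuous_dist.comp_continuousOn ((hyc p).prodMk (hyc p₀))
    have hS : IsCompact (Icc (0 : ℝ) 1 ∩ (fun t => dist (y p t) (y p₀ t)) ⁻¹' Ici ε) :=
      isCompact_Icc.of_isClosed_subset
        (hdc.preimage_isClosed_of_isClosed isClosed_Icc isClosed_Ici) inter_subset_left
    obtain ⟨τ, ⟨hτ, hτε⟩, hmin⟩ := hS.exists_isLeast (hcon.imp fun t ht => ⟨ht.1, ht.2⟩)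
    have hlt : ∀ t ∈ Ico 0 τ, dist (y p t) (y p₀ t) < ε := fun t ht => by
      by_contra! h
      exact absurd (hmin ⟨⟨ht.1, ht.2.le.trans hτ.2⟩, h⟩) (not_le.2 ht.2)
    have hmem : ∀ t ∈ Ico 0 τ, t ∈ Ico (0 : ℝ) 1 := fun t ht => ⟨ht.1, ht.2.trans_le hτ.2⟩
    have hd : ∀ r, ∀ t ∈ Ico 0 τ, HasDerivWithinAt (y r) (g r t (y r t)) (Ici t) t :=
      fun r t ht => (hy r t ⟨ht.1, (hmem t ht).2.le⟩).mono_of_mem_nhdsWithin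
        (Icc_mem_nhdsGE_of_mem (hmem t ht))
    have hin₀ : ∀ t ∈ Ico 0 τ, y p₀ t ∈ Metric.closedBall (0 : E) (R + ε) := fun t ht => by
      rw [mem_closedBall_zero_iff]
      linarith [hR t ⟨ht.1, (hmem t ht).2.le⟩]
    have hin : ∀ t ∈ Ico 0 τ, y p t ∈ Metric.closedBall (0 : E) (R + ε) := fun t ht => by
      rw [mem_closedBall_zero_iff]
      have h1 := hlt t ht
      rw [dist_eq_norm] at h1
      linarith [hR t ⟨ht.1, (hmem t ht).2.le⟩, norm_sub_norm_le (y p t) (y p₀ t)]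
    have hgr := dist_le_of_approx_trajectories_ODE_of_mem (v := g p) (K := M)
      (s := fun _ => Metric.closedBall (0 : E) (R + ε)) (δ := δ) (εf := 0) (εg := δ)
      (fun t ht => (convex_closedBall _ _).lipschitzOnWith_of_nnnorm_hasFDerivWithin_le
        (fun x _ => (hgd p t x).hasFDerivWithinAt)
        (fun x hx => (hp1 (t, x) ⟨⟨ht.1, (hmem t ht).2.le⟩, hx⟩).le))
      ((hyc p).mono (Icc_subset_Icc_right hτ.2)) (hd p) (fun t _ => (dist_self _).le) hin
      ((hyc p₀).mono (Icc_subset_Icc_right hτ.2)) (hd p₀)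
      (fun t ht => (hp2 (t, y p₀ t) ⟨⟨ht.1, (hmem t ht).2.le⟩, hin₀ t ht⟩).le) hin₀ hp3.le
      τ ⟨hτ.1, le_rfl⟩
    have hmono := gronwallBound_mono hδ0.le (by linarith : 0 ≤ 0 + δ) M.2
      (by linarith [hτ.2] : τ - 0 ≤ 1)
    have : ε ≤ dist (y p τ) (y p₀ τ) := hτε
    exact absurd hδ (not_lt.2 (this.trans (hgr.trans hmono)))
  rw [continuous_iff_continuousAt]
  rintro ⟨p₀, t₀⟩
  rw [Metric.continuousAt_iff']
  intro ε hε
  have h2 : ∀ᶠ t : Icc (0 : ℝ) 1 in nhds t₀, dist (y p₀ t) (y p₀ t₀) < ε / 2 :=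
    Metric.continuousAt_iff'.1 (continuousOn_iff_continuous_domRestrict.1 (hyc p₀)).continuousAt _
      (half_pos hε)
  filter_upwards [(key p₀ (ε / 2) (half_pos hε)).prod_nhds h2] with q hq
  calc dist (y q.1 q.2) (y p₀ t₀) ≤ dist (y q.1 q.2) (y p₀ q.2) + dist (y p₀ q.2) (y p₀ t₀) :=
        dist_triangle _ _ _
    _ < ε / 2 + ε / 2 := add_lt_add (hq.1 q.2 q.2.2) hq.2
    _ = ε := add_halves ε

/-- Solutions on `[0, 1]` of a family of ordinary differential equations with `C¹` vector fields
depend in a `C¹` way on the initial value, with a derivative that is jointly continuous in the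
parameter and the initial value. -/
theorem exists_continuous_hasFDerivAt_ode_solution {P H : Type*} [TopologicalSpace P]
    [FirstCountableTopology P] [NormedAddCommGroup H] [NormedSpace ℝ H] [FiniteDimensional ℝ H]
    (g : P → ℝ → H → H) (g' : P → ℝ → H → H →L[ℝ] H)
    (hg : Continuous fun q : P × ℝ × H => g q.1 q.2.1 q.2.2)
    (hg' : Continuous fun q : P × ℝ × H => g' q.1 q.2.1 q.2.2)
    (hgd : ∀ p t x, HasFDerivAt (g p t) (g' p t x) x) (y : P → H → ℝ → H)
    (hy : ∀ p ξ, ∀ t ∈ Icc (0 : ℝ) 1, HasDerivWithinAt (y p ξ) (g p t (y p ξ t)) (Icc 0 1) t)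
    (hy0 : ∀ p ξ, y p ξ 0 = ξ) :
    (Continuous fun q : P × H => y q.1 q.2 1) ∧
      ∃ D : P × H → H →L[ℝ] H, Continuous D ∧
        ∀ p ξ, HasFDerivAt (fun ζ => y p ζ 1) (D (p, ξ)) ξ := by
  have : ProperSpace H := FiniteDimensional.proper_real H
  have : ProperSpace (H →L[ℝ] H) := FiniteDimensional.proper_real _
  have hY : Continuous fun q : (P × H) × Icc (0 : ℝ) 1 => y q.1.1 q.1.2 q.2 :=
    continuous_ode_solution (P := P × H) (fun p => g p.1) (fun p => g' p.1)
      (hg.comp (by fun_prop : Continuous fun q : (P × H) × ℝ × H => (q.1.1, q.2.1, q.2.2)))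
      (hg'.comp (by fun_prop : Continuous fun q : (P × H) × ℝ × H => (q.1.1, q.2.1, q.2.2)))
      (fun p => hgd p.1) (fun p => y p.1 p.2) (fun p => hy p.1 p.2)
      (by simpa [hy0] using continuous_snd)
  have h1 : (1 : ℝ) ∈ Icc (0 : ℝ) 1 := by simp
  refine ⟨hY.comp (by fun_prop : Continuous fun q : P × H => (q, (⟨1, h1⟩ : Icc (0 : ℝ) 1))), ?_⟩
  set z : P → H → ℝ → H := fun p ξ t => y p ξ (projIcc 0 1 zero_le_one t) with hz
  have hzy : ∀ p ξ, ∀ t ∈ Icc (0 : ℝ) 1, z p ξ t = y p ξ t := fun p ξ t ht => by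
    simp [hz, projIcc_of_mem _ ht]
  have hzc : Continuous fun q : P × H × ℝ => z q.1 q.2.1 q.2.2 :=
    hY.comp (by fun_prop : Continuous fun q : P × H × ℝ =>
      ((q.1, q.2.1), projIcc (0 : ℝ) 1 zero_le_one q.2.2))
  set B : (P × H) × H → ℝ → H →L[ℝ] H := fun q t =>
    ∫ θ in (0 : ℝ)..1,
      g' q.1.1 t (z q.1.1 q.1.2 t + θ • (z q.1.1 (q.1.2 + q.2) t - z q.1.1 q.1.2 t)) with hB
  have hBc : Continuous fun r : ((P × H) × H) × ℝ => B r.1 r.2 := by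
    refine intervalIntegral.continuous_parametric_intervalIntegral_of_continuous' ?_ 0 1
    have e1 : Continuous fun w : (((P × H) × H) × ℝ) × ℝ => z w.1.1.1.1 w.1.1.1.2 w.1.2 :=
      hzc.comp (by fun_prop : Continuous fun w : (((P × H) × H) × ℝ) × ℝ =>
        (w.1.1.1.1, w.1.1.1.2, w.1.2))
    have e2 : Continuous fun w : (((P × H) × H) × ℝ) × ℝ =>
        z w.1.1.1.1 (w.1.1.1.2 + w.1.1.2) w.1.2 :=
      hzc.comp (by fun_prop : Continuous fun w : (((P × H) × H) × ℝ) × ℝ =>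
        (w.1.1.1.1, w.1.1.1.2 + w.1.1.2, w.1.2))
    exact hg'.comp (by fun_prop : Continuous fun w : (((P × H) × H) × ℝ) × ℝ =>
      (w.1.1.1.1, w.1.2, z w.1.1.1.1 w.1.1.1.2 w.1.2 +
        w.2 • (z w.1.1.1.1 (w.1.1.1.2 + w.1.1.2) w.1.2 - z w.1.1.1.1 w.1.1.1.2 w.1.2)))
  have hBt : ∀ q, Continuous (B q) := fun q =>
    hBc.comp (by fun_prop : Continuous fun t : ℝ => (q, t))
  have hadamard : ∀ p ξ h, ∀ t ∈ Icc (0 : ℝ) 1, g p t (y p (ξ + h) t) - g p t (y p ξ t) =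
      B ((p, ξ), h) t (y p (ξ + h) t - y p ξ t) := by
    intro p ξ h t ht
    set a := y p ξ t
    set b := y p (ξ + h) t
    have hc : Continuous fun θ : ℝ => g' p t (a + θ • (b - a)) :=
      hg'.comp (by fun_prop : Continuous fun θ : ℝ => (p, t, a + θ • (b - a)))
    have hder : ∀ θ ∈ uIcc (0 : ℝ) 1, HasDerivAt (fun θ : ℝ => g p t (a + θ • (b - a)))
        (g' p t (a + θ • (b - a)) (b - a)) θ := fun θ _ => by
      have h2 : HasDerivAt (fun θ : ℝ => a + θ • (b - a)) (b - a) θ := by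
        simpa using ((hasDerivAt_id θ).smul_const (b - a)).const_add a
      exact (hgd p t _).comp_hasDerivAt θ h2
    have hint := intervalIntegral.integral_eq_sub_of_hasDerivAt hder
      ((hc.clm_apply continuous_const).intervalIntegrable 0 1)
    simp only [hB, hzy p ξ t ht, hzy p (ξ + h) t ht]
    rw [ContinuousLinearMap.intervalIntegral_apply (hc.intervalIntegrable 0 1), hint]
    simp
  choose Φ hΦ0 hΦ using fun q : (P × H) × H => exists_linear_ode_solution
    (fun t => ContinuousLinearMap.compL ℝ H H H (B q t))
    ((ContinuousLinearMap.compL ℝ H H H).continuous.comp (hBt q)) (ContinuousLinearMap.id ℝ H)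
  have hcomp : Continuous fun r : ((P × H) × H) × ℝ × (H →L[ℝ] H) =>
      ContinuousLinearMap.compL ℝ H H H (B r.1 r.2.1) :=
    (ContinuousLinearMap.compL ℝ H H H).continuous.comp
      (hBc.comp (by fun_prop : Continuous fun r : ((P × H) × H) × ℝ × (H →L[ℝ] H) =>
        (r.1, r.2.1)))
  have hΦc : Continuous fun q : ((P × H) × H) × Icc (0 : ℝ) 1 => Φ q.1 q.2 :=
    continuous_ode_solution
      (fun q t A => ContinuousLinearMap.compL ℝ H H H (B q t) A)
      (fun q t _ => ContinuousLinearMap.compL ℝ H H H (B q t))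
      (hcomp.clm_apply (by fun_prop)) hcomp
      (fun q t A => (ContinuousLinearMap.compL ℝ H H H (B q t)).hasFDerivAt) Φ hΦ
      (by simpa only [hΦ0] using continuous_const)
  have hdiff : ∀ p ξ h, y p (ξ + h) 1 - y p ξ 1 = Φ ((p, ξ), h) 1 h := by
    intro p ξ h
    obtain ⟨M, hM⟩ := (isCompact_Icc (a := (0 : ℝ)) (b := 1)).exists_bound_of_continuousOn
      (hBt ((p, ξ), h)).continuousOn
    have hd : ∀ t ∈ Icc (0 : ℝ) 1, HasDerivWithinAt
        (fun t => y p (ξ + h) t - y p ξ t - Φ ((p, ξ), h) t h)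
        (B ((p, ξ), h) t (y p (ξ + h) t - y p ξ t - Φ ((p, ξ), h) t h)) (Icc 0 1) t := by
      intro t ht
      have h3 : HasDerivWithinAt (fun t => Φ ((p, ξ), h) t h)
          (B ((p, ξ), h) t (Φ ((p, ξ), h) t h)) (Icc 0 1) t := by
        simpa using (hΦ ((p, ξ), h) t ht).clm_apply (hasDerivWithinAt_const t (Icc 0 1) h)
      rw [map_sub, ← hadamard p ξ h t ht]
      exact ((hy p (ξ + h) t ht).sub (hy p ξ t ht)).sub h3
    have := eq_zero_of_abs_deriv_le_mul_abs_self_of_eq_zero_right (K := M)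
      (fun t ht => (hd t ht).continuousWithinAt)
      (fun t ht => (hd t ⟨ht.1, ht.2.le⟩).mono_of_mem_nhdsWithin (Icc_mem_nhdsGE_of_mem ht))
      (by simp [hy0, hΦ0])
      (fun t ht => ContinuousLinearMap.le_of_opNorm_le _ (hM t ⟨ht.1, ht.2.le⟩) _) 1 h1
    exact sub_eq_zero.1 this
  have hΦ1 : Continuous fun q => Φ q 1 :=
    hΦc.comp (by fun_prop : Continuous fun q : (P × H) × H => (q, (⟨1, h1⟩ : Icc (0 : ℝ) 1)))
  refine ⟨fun q => Φ (q, 0) 1, hΦ1.comp (by fun_prop), fun p ξ => ?_⟩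
  rw [hasFDerivAt_iff_isLittleO_nhds_zero, Asymptotics.isLittleO_iff]
  intro c hc
  have hcont : Continuous fun h : H => ‖Φ ((p, ξ), h) 1 - Φ ((p, ξ), 0) 1‖ :=
    ((hΦ1.comp (by fun_prop : Continuous fun h : H => ((p, ξ), h))).sub continuous_const).norm
  filter_upwards [(hcont.tendsto 0).eventually_lt_const (by simpa using hc)] with h hh
  rw [hdiff, ← sub_apply]
  exact ContinuousLinearMap.le_of_opNorm_le _ hh.le _

/-- The flow of a mild equation `x' = A x + F x + o'` with `C¹` nonlinearity is of class
`C^{0,0,1}`. -/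
theorem mild_solution_flow_contDiff {H : Type*} [NormedAddCommGroup H] [NormedSpace ℝ H]
    [FiniteDimensional ℝ H] (L : ℝ → H →L[ℝ] H) (hLc : Continuous L)
    (hL0 : ∀ v, L 0 v = v) (hLadd : ∀ s t v, L s (L t v) = L (s + t) v)
    (T : ℝ) (hT : 0 ≤ T) (F : H → H) (hF : ContDiff ℝ 1 F) (o : ℝ → H)
    (ho : ContinuousOn o (Icc 0 T)) (x : ℝ → ℝ → H → H)
    (hxc : ∀ s ∈ Icc 0 T, ∀ ξ, ContinuousOn (fun t => x s t ξ) (Icc s T))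
    (hx : ∀ s ∈ Icc 0 T, ∀ ξ, ∀ t ∈ Icc s T,
      x s t ξ = L (t - s) ξ + (∫ u in s..t, L (t - u) (F (x s u ξ))) + o t - L (t - s) (o s)) :
    ContinuousOn (fun p : ℝ × ℝ × H => x p.1 p.2.1 p.2.2)
        {p : ℝ × ℝ × H | 0 ≤ p.1 ∧ p.1 ≤ p.2.1 ∧ p.2.1 ≤ T} ∧
      (∀ s t : ℝ, 0 ≤ s → s ≤ t → t ≤ T → ∀ ξ, DifferentiableAt ℝ (fun z => x s t z) ξ) ∧
      ContinuousOn (fun p : ℝ × ℝ × H => fderiv ℝ (fun z => x p.1 p.2.1 z) p.2.2)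
        {p : ℝ × ℝ × H | 0 ≤ p.1 ∧ p.1 ≤ p.2.1 ∧ p.2.1 ≤ T} := by
  obtain ⟨e, hec, heo⟩ : ∃ e : ℝ → H, Continuous e ∧ ∀ t ∈ Icc 0 T, e t = o t :=
    ⟨IccExtend hT ((Icc 0 T).domRestrict o),
      (continuousOn_iff_continuous_domRestrict.1 ho).Icc_extend',
      fun t ht => by rw [IccExtend_of_mem _ _ ht, domRestrict_apply]⟩
  set w : ℝ → H → ℝ → H := fun s ξ r => L (-r) (x s r (L s ξ + o s) - o r) with hw
  have hxw : ∀ s ξ r, x s r (L s ξ + o s) = L r (w s ξ r) + o r := fun s ξ r => by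
    simp [hw, hLadd, hL0]
  have hwint : ∀ s ∈ Icc 0 T, ∀ ξ, ∀ r ∈ Icc s T,
      w s ξ r = ξ + ∫ u in s..r, L (-u) (F (x s u (L s ξ + o s))) := by
    intro s hs ξ r hr
    have hcu : ContinuousOn (fun u => L (r - u) (F (x s u (L s ξ + o s)))) (Icc s r) :=
      (hLc.comp (by fun_prop : Continuous fun u => r - u)).continuousOn.clm_apply
        (hF.continuous.comp_continuousOn ((hxc s hs _).mono (Icc_subset_Icc_right hr.2)))
    have hI : L (-r) (∫ u in s..r, L (r - u) (F (x s u (L s ξ + o s)))) =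
        ∫ u in s..r, L (-u) (F (x s u (L s ξ + o s))) := by
      rw [← ContinuousLinearMap.intervalIntegral_comp_comm _
        (hcu.intervalIntegrable_of_Icc hr.1)]
      have hru : ∀ u, -r + (r - u) = -u := fun u => by ring
      simp only [hLadd, hru]
    simp only [hw]
    rw [hx s hs _ r hr, map_add, hLadd, ← hI, ← sub_eq_zero]
    simp only [map_add, map_sub, hLadd]
    simp [hL0]
    abel
  have hw0 : ∀ s ∈ Icc 0 T, ∀ ξ, w s ξ s = ξ := fun s hs ξ => by
    rw [hwint s hs ξ s ⟨le_rfl, hs.2⟩]; simp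
  have hwd : ∀ s ∈ Icc 0 T, ∀ ξ, ∀ r ∈ Icc s T,
      HasDerivWithinAt (w s ξ) (L (-r) (F (L r (w s ξ r) + e r))) (Icc s T) r := by
    intro s hs ξ r hr
    set ψ : ℝ → H := fun u => L (-u) (F (x s u (L s ξ + o s))) with hψ
    have hψc : ContinuousOn ψ (Icc s T) :=
      (hLc.comp continuous_neg).continuousOn.clm_apply
        (hF.continuous.comp_continuousOn (hxc s hs _))
    set χ : ℝ → H := IccExtend hs.2 ((Icc s T).domRestrict ψ) with hχ
    have hχc : Continuous χ := (continuousOn_iff_continuous_domRestrict.1 hψc).Icc_extend'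
    have hχψ : ∀ u ∈ Icc s T, χ u = ψ u := fun u hu => by
      rw [hχ, IccExtend_of_mem _ _ hu, domRestrict_apply]
    have hweq : ∀ u ∈ Icc s T, w s ξ u = ξ + ∫ v in s..u, χ v := fun u hu => by
      rw [hwint s hs ξ u hu]
      congr 1
      refine intervalIntegral.integral_congr fun v hv => ?_
      rw [uIcc_of_le hu.1] at hv
      exact (hχψ v ⟨hv.1, hv.2.trans hu.2⟩).symm
    have hd : HasDerivWithinAt (fun u => ξ + ∫ v in s..u, χ v) (χ r) (Icc s T) r :=
      ((hχc.integral_hasStrictDerivAt s r).hasDerivAt.const_add ξ).hasDerivWithinAt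
    have hval : L (-r) (F (L r (w s ξ r) + e r)) = χ r := by
      rw [hχψ r hr, heo r ⟨hs.1.trans hr.1, hr.2⟩, ← hxw]
    rw [hval]
    exact hd.congr hweq (hweq r hr)
  let Δ := {p : ℝ × ℝ | 0 ≤ p.1 ∧ p.1 ≤ p.2 ∧ p.2 ≤ T}
  have hΔ : ∀ p : Δ, p.1.1 ∈ Icc 0 T := fun p => ⟨p.2.1, p.2.2.1.trans p.2.2.2⟩
  have hmaps : ∀ p : Δ, MapsTo (fun σ : ℝ => p.1.1 + σ * (p.1.2 - p.1.1)) (Icc 0 1)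
      (Icc p.1.1 T) := by
    rintro ⟨⟨s, t⟩, h0, h1, h2⟩ σ ⟨hσ0, hσ1⟩
    simp only at h0 h1 h2 ⊢
    constructor <;> nlinarith
  obtain ⟨F', hF'c, hF'⟩ : ∃ F' : H → H →L[ℝ] H, Continuous F' ∧ ∀ v, HasFDerivAt F (F' v) v :=
    ⟨fderiv ℝ F, hF.continuous_fderiv one_ne_zero,
      fun v => (hF.differentiable one_ne_zero v).hasFDerivAt⟩
  have hFc := hF.continuous
  obtain ⟨hyc, D, hDc, hD⟩ := exists_continuous_hasFDerivAt_ode_solution (P := Δ)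
    (fun p σ v => (p.1.2 - p.1.1) • L (-(p.1.1 + σ * (p.1.2 - p.1.1)))
      (F (L (p.1.1 + σ * (p.1.2 - p.1.1)) v + e (p.1.1 + σ * (p.1.2 - p.1.1)))))
    (fun p σ v => (p.1.2 - p.1.1) • (L (-(p.1.1 + σ * (p.1.2 - p.1.1)))).comp
      ((F' (L (p.1.1 + σ * (p.1.2 - p.1.1)) v + e (p.1.1 + σ * (p.1.2 - p.1.1)))).comp
        (L (p.1.1 + σ * (p.1.2 - p.1.1)))))
    (by fun_prop) (by fun_prop)
    (fun p σ v => by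
      have h1 := (L (p.1.1 + σ * (p.1.2 - p.1.1))).hasFDerivAt (x := v)
      exact (((L _).hasFDerivAt.comp v ((hF' _).comp v (h1.add_const _))).const_smul _))
    (fun p ξ σ => w p.1.1 ξ (p.1.1 + σ * (p.1.2 - p.1.1)))
    (fun p ξ σ hσ => by
      have h1 : HasDerivWithinAt (fun σ : ℝ => p.1.1 + σ * (p.1.2 - p.1.1)) (p.1.2 - p.1.1)
          (Icc 0 1) σ := by
        simpa using (((hasDerivAt_id σ).mul_const (p.1.2 - p.1.1)).const_add
          p.1.1).hasDerivWithinAt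
      exact (hwd p.1.1 (hΔ p) ξ _ (hmaps p hσ)).scomp σ h1 (hmaps p))
    (fun p ξ => by simpa using hw0 p.1.1 (hΔ p) ξ)
  simp only [one_mul, add_sub_cancel] at hyc hD
  have hxy : ∀ s t z, x s t z = L t (w s (L (-s) (z - o s)) t) + o t := fun s t z => by
    rw [← hxw]; simp [hLadd, hL0]
  have hder : ∀ (p : Δ) ξ, HasFDerivAt (fun z => x p.1.1 p.1.2 z)
      ((L p.1.2).comp ((D (p, L (-p.1.1) (ξ - o p.1.1))).comp (L (-p.1.1)))) ξ := fun p ξ => by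
    have h1 : HasFDerivAt (fun z => L (-p.1.1) (z - o p.1.1)) (L (-p.1.1)) ξ :=
      (L (-p.1.1)).hasFDerivAt.comp ξ ((hasFDerivAt_id ξ).sub_const _)
    simp only [hxy p.1.1 p.1.2]
    exact ((L p.1.2).hasFDerivAt.comp ξ ((hD p _).comp ξ h1)).add_const _
  have hproj : Continuous fun q : {p : ℝ × ℝ × H | 0 ≤ p.1 ∧ p.1 ≤ p.2.1 ∧ p.2.1 ≤ T} =>
      ((⟨(q.1.1, q.1.2.1), q.2⟩ : Δ), L (-q.1.1) (q.1.2.2 - e q.1.1)) := by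
    fun_prop
  have heo' : ∀ q : {p : ℝ × ℝ × H | 0 ≤ p.1 ∧ p.1 ≤ p.2.1 ∧ p.2.1 ≤ T},
      e q.1.1 = o q.1.1 ∧ e q.1.2.1 = o q.1.2.1 := fun q =>
    ⟨heo _ ⟨q.2.1, q.2.2.1.trans q.2.2.2⟩, heo _ ⟨q.2.1.trans q.2.2.1, q.2.2.2⟩⟩
  refine ⟨?_, fun s t h0 h1 h2 ξ => (hder ⟨(s, t), h0, h1, h2⟩ ξ).differentiableAt, ?_⟩
  · rw [continuousOn_iff_continuous_domRestrict]
    have h1 := hyc.comp hproj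
    have h2 : Continuous fun q : {p : ℝ × ℝ × H | 0 ≤ p.1 ∧ p.1 ≤ p.2.1 ∧ p.2.1 ≤ T} =>
        L q.1.2.1 (w q.1.1 (L (-q.1.1) (q.1.2.2 - e q.1.1)) q.1.2.1) + e q.1.2.1 :=
      ((hLc.comp (by fun_prop)).clm_apply h1).add (hec.comp (by fun_prop))
    refine h2.congr fun q => ?_
    rw [domRestrict_apply, hxy, (heo' q).1, (heo' q).2]
  · rw [continuousOn_iff_continuous_domRestrict]
    have h1 := hDc.comp hproj
    have h2 : Continuous fun q : {p : ℝ × ℝ × H | 0 ≤ p.1 ∧ p.1 ≤ p.2.1 ∧ p.2.1 ≤ T} =>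
        (L q.1.2.1).comp ((D ((⟨(q.1.1, q.1.2.1), q.2⟩ : Δ),
          L (-q.1.1) (q.1.2.2 - e q.1.1))).comp (L (-q.1.1))) :=
      (hLc.comp (by fun_prop : Continuous fun q :
        {p : ℝ × ℝ × H | 0 ≤ p.1 ∧ p.1 ≤ p.2.1 ∧ p.2.1 ≤ T} => q.1.2.1)).clm_comp
        (h1.clm_comp (hLc.comp (by fun_prop : Continuous fun q :
          {p : ℝ × ℝ × H | 0 ≤ p.1 ∧ p.1 ≤ p.2.1 ∧ p.2.1 ≤ T} => -q.1.1)))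
    refine h2.congr fun q => ?_
    rw [domRestrict_apply, (hder ⟨(q.1.1, q.1.2.1), q.2⟩ q.1.2.2).fderiv, (heo' q).1]

theorem measurable_fderiv_apply_of_measurable {α H K : Type*} [MeasurableSpace α]
    [NormedAddCommGroup H] [NormedSpace ℝ H] [NormedAddCommGroup K] [NormedSpace ℝ K]
    [MeasurableSpace K] [BorelSpace K] [SecondCountableTopology K] {f : H → α → K}
    (hf : ∀ x, Measurable (f x)) {x : H} (hd : ∀ a, DifferentiableAt ℝ (fun z => f z a) x)
    (v : H) : Measurable fun a => fderiv ℝ (fun z => f z a) x v := by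
  refine measurable_of_tendsto_metrizable
    (f := fun (n : ℕ) a => (n : ℝ) • (f (x + (n : ℝ)⁻¹ • v) a - f x a))
    (fun n => ((hf _).sub (hf _)).const_smul _) (tendsto_pi_nhds.2 fun a => ?_)
  refine (hd a).hasFDerivAt.lim v ?_
  exact tendsto_norm_atTop_atTop.comp tendsto_natCast_atTop_atTop

theorem measurable_of_measurable_apply {α H K ι : Type*} [MeasurableSpace α] [Fintype ι]
    [NormedAddCommGroup H] [InnerProductSpace ℝ H] [NormedAddCommGroup K] [NormedSpace ℝ K]
    [MeasurableSpace K] [BorelSpace K] [SecondCountableTopology K]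
    [MeasurableSpace (H →L[ℝ] K)] [BorelSpace (H →L[ℝ] K)]
    (b : OrthonormalBasis ι ℝ H) {A : α → H →L[ℝ] K}
    (hA : ∀ v, Measurable fun a => A a v) : Measurable A := by
  have hc : Continuous fun k : ι → K => ∑ i, (innerSL ℝ (b i)).smulRight (k i) :=
    continuous_finsetSum _ fun i _ =>
      (ContinuousLinearMap.smulRightL ℝ H K (innerSL ℝ (b i))).continuous.comp
        (continuous_apply i)
  convert hc.measurable.comp (measurable_pi_iff.2 fun i => hA (b i)) using 1
  ext a v
  conv_lhs => rw [← b.sum_repr' v]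
  simp

/-- Probability-space version: for the flows `X_{s,t}^x(ω)` solving the
mild equation with a noise process `O` with continuous sample paths, jointly measurable
processes `Y, Z : [0,T] × Ω → H`, and `Δ_T = {(s,t) : 0 ≤ s ≤ t ≤ T}`:
(i) for every `ω` the map `(s,t,x) ↦ X_{s,t}^x(ω)` is of class `C^{0,0,1}` on `Δ_T × H`;
(ii) `(s,t,ω) ↦ X_{s,t}^{Y_s(ω)}(ω)` is `(ℬ(Δ_T) ⊗ 𝔉)/ℬ(H)`-measurable; and
(iii) `(s,t,ω) ↦ ∂_x X_{s,t}^{Z_s(ω)}(ω)` is `(ℬ(Δ_T) ⊗ 𝔉)/ℬ(L(H))`-measurable. -/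
theorem stmt_5
    {H : Type*} [NormedAddCommGroup H] [InnerProductSpace ℝ H]
    [FiniteDimensional ℝ H] [Nontrivial H] [MeasurableSpace H] [BorelSpace H]
    [MeasurableSpace (H →L[ℝ] H)] [BorelSpace (H →L[ℝ] H)]
    {ι : Type*} [Fintype ι] (b : OrthonormalBasis ι ℝ H)
    (lam : ι → ℝ) (hlam : ∀ i, lam i < 0)
    (E : ℝ → H → H)
    (hE : ∀ t v, E t v = ∑ i, (Real.exp (t * lam i) * ⟪b i, v⟫) • b i)
    {Ω : Type*} [MeasurableSpace Ω] (Pr : Measure Ω) [IsProbabilityMeasure Pr]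
    (T : ℝ) (hT : 0 < T)
    (F : H → H) (hF : ContDiff ℝ 1 F)
    (Y Z : ℝ → Ω → H)
    (hY : Measurable fun p : Set.Icc (0 : ℝ) T × Ω => Y (↑p.1) p.2)
    (hZ : Measurable fun p : Set.Icc (0 : ℝ) T × Ω => Z (↑p.1) p.2)
    (O : ℝ → Ω → H)
    (hOmeas : ∀ t, Measurable fun ω => O t ω)
    (hOcont : ∀ ω, ContinuousOn (fun t => O t ω) (Set.Icc (0 : ℝ) T))
    (X : ℝ → ℝ → H → Ω → H)
    (hXmeas : ∀ s t x, Measurable fun ω => X s t x ω)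
    (hXcont : ∀ s ∈ Set.Icc (0 : ℝ) T, ∀ x : H, ∀ ω,
      ContinuousOn (fun t => X s t x ω) (Set.Icc s T))
    (hXeq : ∀ s ∈ Set.Icc (0 : ℝ) T, ∀ x : H, ∀ t ∈ Set.Icc s T, ∀ ω,
      X s t x ω = E (t - s) x + (∫ u in s..t, E (t - u) (F (X s u x ω))) + O t ω
        - E (t - s) (O s ω)) :
    (∀ ω,
      ContinuousOn (fun p : ℝ × ℝ × H => X p.1 p.2.1 p.2.2 ω)
          {p : ℝ × ℝ × H | 0 ≤ p.1 ∧ p.1 ≤ p.2.1 ∧ p.2.1 ≤ T} ∧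
      (∀ s t : ℝ, 0 ≤ s → s ≤ t → t ≤ T → ∀ x : H,
        DifferentiableAt ℝ (fun z => X s t z ω) x) ∧
      ContinuousOn (fun p : ℝ × ℝ × H => fderiv ℝ (fun z => X p.1 p.2.1 z ω) p.2.2)
          {p : ℝ × ℝ × H | 0 ≤ p.1 ∧ p.1 ≤ p.2.1 ∧ p.2.1 ≤ T}) ∧
    Measurable (fun q : {p : ℝ × ℝ | 0 ≤ p.1 ∧ p.1 ≤ p.2 ∧ p.2 ≤ T} × Ω =>
      X (q.1 : ℝ × ℝ).1 (q.1 : ℝ × ℝ).2 (Y (q.1 : ℝ × ℝ).1 q.2) q.2) ∧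
    Measurable (fun q : {p : ℝ × ℝ | 0 ≤ p.1 ∧ p.1 ≤ p.2 ∧ p.2 ≤ T} × Ω =>
      fderiv ℝ (fun z => X (q.1 : ℝ × ℝ).1 (q.1 : ℝ × ℝ).2 z q.2)
        (Z (q.1 : ℝ × ℝ).1 q.2)) := by
  have : ProperSpace H := FiniteDimensional.proper ℝ H
  let L : ℝ → H →L[ℝ] H := fun t =>
    ∑ i, Real.exp (t * lam i) • (innerSL ℝ (b i)).smulRight (b i)
  have hLE : ∀ t v, E t v = L t v := fun t v => by simp [hE, L, mul_smul]
  have hLc : Continuous L := continuous_finsetSum _ fun i _ => by fun_prop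
  have hL0 : ∀ v, L 0 v = v := fun v => by simpa [L] using b.sum_repr' v
  have hLadd : ∀ s t v, L s (L t v) = L (s + t) v := fun s t v => by
    have hin : ∀ i, ⟪b i, L t v⟫ = Real.exp (t * lam i) * ⟪b i, v⟫ := fun i => by
      rw [← hLE, hE, b.orthonormal.inner_right_fintype]
    rw [← hLE, ← hLE (s + t), hE, hE]
    exact Finset.sum_congr rfl fun i _ => by rw [hin, add_mul, Real.exp_add, mul_assoc]
  simp only [hLE] at hXeq
  have hflow := fun ω => mild_solution_flow_contDiff L hLc hL0 hLadd T hT.le F hF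
    (fun t => O t ω) (hOcont ω) (fun s t ξ => X s t ξ ω)
    (fun s hs ξ => hXcont s hs ξ ω) (fun s hs ξ t ht => hXeq s hs ξ t ht ω)
  let Δ := {p : ℝ × ℝ | 0 ≤ p.1 ∧ p.1 ≤ p.2 ∧ p.2 ≤ T}
  have hmaps : Continuous fun q : Δ × H => (⟨(q.1.1.1, q.1.1.2, q.2), q.1.2⟩ :
      {p : ℝ × ℝ × H | 0 ≤ p.1 ∧ p.1 ≤ p.2.1 ∧ p.2.1 ≤ T}) := by
    fun_prop
  have hsub : Measurable fun q : Δ × Ω =>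
      ((⟨q.1.1.1, q.1.2.1, q.1.2.2.1.trans q.1.2.2.2⟩ : Icc (0 : ℝ) T), q.2) :=
    ((measurable_subtype_coe.comp measurable_fst).fst.subtype_mk).prodMk measurable_snd
  refine ⟨hflow, ?_, ?_⟩
  · have hm : Measurable (Function.uncurry fun (q : Δ × H) ω => X q.1.1.1 q.1.1.2 q.2 ω) :=
      measurable_uncurry_of_continuous_of_measurable
        (fun ω => (continuousOn_iff_continuous_domRestrict.1 (hflow ω).1).comp hmaps)
        fun q => hXmeas _ _ _
    exact hm.comp ((measurable_fst.prodMk (hY.comp hsub)).prodMk measurable_snd)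
  · have hm : Measurable (Function.uncurry fun (q : Δ × H) ω =>
        fderiv ℝ (fun z => X q.1.1.1 q.1.1.2 z ω) q.2) :=
      measurable_uncurry_of_continuous_of_measurable
        (fun ω => (continuousOn_iff_continuous_domRestrict.1 (hflow ω).2.2).comp hmaps)
        fun q => measurable_of_measurable_apply b fun v =>
          measurable_fderiv_apply_of_measurable (fun z => hXmeas _ _ z)
            (fun ω => (hflow ω).2.1 _ _ q.1.2.1 q.1.2.2.1 q.1.2.2.2 _) v
    exact hm.comp ((measurable_fst.prodMk (hZ.comp hsub)).prodMk measurable_snd)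
end
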